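/- Let H ⊆ ℕ be an infinite set that is uniformly homogeneous for the labelled linear ordering M = (ℕ, <, P₁, …, Pₙ). Then the MSO theory of the expansion M' = (ℕ, <, H, P₁, …, Pₙ) is recursive in (Turing reducible to) the join of the sets H, P₁, …, Pₙ. -/

import Mathlib

namespace Paper

/-! ## Syntax and semantics of monadic second-order logic over labelled linear orders

A labelled linear ordering `M = (A, <, P₁, …, Pₙ)` is represented by a type `A`,
a binary relation `r : A → A → Prop` (the order) and `P : Fin n → Set A`
(the unary predicates). -/

/-- MSO formulas over the signature `{<, P₀, …, P_{n-1}}`.  First-order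
variables and second-order (set) variables are both indexed by `ℕ`. -/
inductive MSO (n : ℕ) : Type
  | lt (i j : ℕ) : MSO n
  | pred (k : Fin n) (i : ℕ) : MSO n
  | mem (i j : ℕ) : MSO n
  | not (φ : MSO n) : MSO n
  | and (φ ψ : MSO n) : MSO n
  | ex1 (i : ℕ) (φ : MSO n) : MSO n
  | ex2 (j : ℕ) (φ : MSO n) : MSO n

namespace MSO

variable {n : ℕ}

/-- Satisfaction of an MSO formula in the structure `(A, r, P)` under the
first-order assignment `v` and the second-order assignment `V`. -/
def Sat {A : Type} (r : A → A → Prop) (P : Fin n → Set A)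
    (v : ℕ → A) (V : ℕ → Set A) : MSO n → Prop
  | lt i j => r (v i) (v j)
  | pred k i => v i ∈ P k
  | mem i j => v i ∈ V j
  | not φ => ¬ Sat r P v V φ
  | and φ ψ => Sat r P v V φ ∧ Sat r P v V ψ
  | ex1 i φ => ∃ a : A, Sat r P (Function.update v i a) V φ
  | ex2 j φ => ∃ S : Set A, Sat r P v (Function.update V j S) φ

/-- Quantifier depth of an MSO formula. -/
def qd : MSO n → ℕ
  | lt _ _ => 0
  | pred _ _ => 0
  | mem _ _ => 0
  | not φ => qd φ
  | and φ ψ => max (qd φ) (qd ψ)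
  | ex1 _ φ => qd φ + 1
  | ex2 _ φ => qd φ + 1

/-- Free first-order variables of an MSO formula. -/
def fv1 : MSO n → Finset ℕ
  | lt i j => {i, j}
  | pred _ i => {i}
  | mem i _ => {i}
  | not φ => fv1 φ
  | and φ ψ => fv1 φ ∪ fv1 ψ
  | ex1 i φ => fv1 φ \ {i}
  | ex2 _ φ => fv1 φ

/-- Free second-order variables of an MSO formula. -/
def fv2 : MSO n → Finset ℕ
  | lt _ _ => ∅
  | pred _ _ => ∅
  | mem _ j => {j}
  | not φ => fv2 φ
  | and φ ψ => fv2 φ ∪ fv2 ψ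
  | ex1 _ φ => fv2 φ
  | ex2 j φ => fv2 φ \ {j}

/-- A sentence is a formula with no free variables. -/
def IsSentence (φ : MSO n) : Prop := fv1 φ = ∅ ∧ fv2 φ = ∅

/-- A sentence `φ` is true in the structure `(A, r, P)`. -/
def TrueIn {A : Type} (r : A → A → Prop) (P : Fin n → Set A) (φ : MSO n) : Prop :=
  ∀ (v : ℕ → A) (V : ℕ → Set A), Sat r P v V φ

/-- `Q ⊆ A` is MSO-definable in `(A, r, P)`: there is a formula `φ(x)` whose only
free variable is the first-order variable `0` defining `Q`. -/
def Definable {A : Type} (r : A → A → Prop) (P : Fin n → Set A) (Q : Set A) : Prop :=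
  ∃ φ : MSO n, fv1 φ ⊆ {0} ∧ fv2 φ = ∅ ∧
    ∀ a : A, a ∈ Q ↔ ∀ (v : ℕ → A) (V : ℕ → Set A), Sat r P (Function.update v 0 a) V φ

/-- A Gödel numbering of MSO formulas. -/
def encode : MSO n → ℕ
  | lt i j => Nat.pair 0 (Nat.pair i j)
  | pred k i => Nat.pair 1 (Nat.pair k i)
  | mem i j => Nat.pair 2 (Nat.pair i j)
  | not φ => Nat.pair 3 (encode φ)
  | and φ ψ => Nat.pair 4 (Nat.pair (encode φ) (encode ψ))
  | ex1 i φ => Nat.pair 5 (Nat.pair i (encode φ))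
  | ex2 j φ => Nat.pair 6 (Nat.pair j (encode φ))

/-- The MSO theory of the structure `(A, r, P)`, as a set of Gödel codes of the true
sentences. -/
def TheoryCodes {A : Type} (r : A → A → Prop) (P : Fin n → Set A) : Set ℕ :=
  {c | ∃ φ : MSO n, IsSentence φ ∧ encode φ = c ∧ TrueIn r P φ}

/-- Two structures have the same `k`-type: they satisfy the same MSO sentences of
quantifier depth `≤ k`. -/
def EquivType (k : ℕ) {A B : Type} (r : A → A → Prop) (P : Fin n → Set A)
    (s : B → B → Prop) (Q : Fin n → Set B) : Prop :=
  ∀ φ : MSO n, IsSentence φ → qd φ ≤ k → (TrueIn r P φ ↔ TrueIn s Q φ)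

/-- The `k`-type of a structure, as the set of Gödel codes of the true sentences
of quantifier depth `≤ k`. -/
def TypeSet (k : ℕ) {A : Type} (r : A → A → Prop) (P : Fin n → Set A) : Set ℕ :=
  {c | ∃ φ : MSO n, IsSentence φ ∧ qd φ ≤ k ∧ encode φ = c ∧ TrueIn r P φ}

end MSO

/-- The order relation of the substructure with domain `S`. -/
def subRel {A : Type} (r : A → A → Prop) (S : Set A) : S → S → Prop :=
  fun x y => r x y

/-- The predicates of the substructure with domain `S`. -/
def subPred {A : Type} {n : ℕ} (P : Fin n → Set A) (S : Set A) : Fin n → Set S :=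
  fun k => {x : S | (x : A) ∈ P k}

/-! ## Relative computability -/

/-- Partial recursiveness relative to an oracle `O` (Kleene-style, following
the definition of `Nat.Partrec`, with an extra base case for the oracle). -/
inductive RecursiveIn (O : ℕ →. ℕ) : (ℕ →. ℕ) → Prop
  | zero : RecursiveIn O (pure 0)
  | succ : RecursiveIn O ↑Nat.succ
  | left : RecursiveIn O ↑fun n : ℕ => n.unpair.1
  | right : RecursiveIn O ↑fun n : ℕ => n.unpair.2
  | oracle : RecursiveIn O O
  | pair {f g} : RecursiveIn O f → RecursiveIn O g →
      RecursiveIn O fun n => Nat.pair <$> f n <*> g n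
  | comp {f g} : RecursiveIn O f → RecursiveIn O g →
      RecursiveIn O fun n => g n >>= f
  | prec {f g} : RecursiveIn O f → RecursiveIn O g →
      RecursiveIn O (Nat.unpaired fun a m =>
        m.rec (f a) fun y IH => do let i ← IH; g (Nat.pair a (Nat.pair y i)))
  | rfind {f} : RecursiveIn O f →
      RecursiveIn O fun a => Nat.rfind fun m => (fun x => x = 0) <$> f (Nat.pair a m)

/-- The characteristic (partial) function of a set of naturals. -/
noncomputable def chi (S : Set ℕ) : ℕ →. ℕ :=
  fun m => Part.some (S.indicator (fun _ => 1) m)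

/-- `S` is recursive in (Turing reducible to) `T`. -/
def TuringRed (S T : Set ℕ) : Prop := RecursiveIn (chi T) (chi S)

/-- The (recursive) join of a finite family of sets of naturals. -/
def finJoin {m : ℕ} (P : Fin m → Set ℕ) : Set ℕ :=
  {c | ∃ i : Fin m, ∃ x : ℕ, c = Nat.pair i x ∧ x ∈ P i}

/-- The (recursive) join of two sets of naturals. -/
def setJoin (S T : Set ℕ) : Set ℕ :=
  {c | (∃ a, c = 2 * a ∧ a ∈ S) ∨ (∃ a, c = 2 * a + 1 ∧ a ∈ T)}

/-- A set of naturals is decidable (computable). -/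
def DecidableSet (S : Set ℕ) : Prop := ComputablePred (· ∈ S)

/-! ## Homogeneous sets for labelled orderings of the naturals -/

/-- `H = {h 0 < h 1 < ⋯}` is `k`-homogeneous for `(ℕ, <, P)`:
all substructures `M_{[h i, h j)}`, `i < j`, have the same `k`-type. -/
def KHomogeneous {n : ℕ} (P : Fin n → Set ℕ) (h : ℕ → ℕ) (k : ℕ) : Prop :=
  ∀ i j i' j' : ℕ, i < j → i' < j' →
    MSO.EquivType k
      (subRel (· < ·) (Set.Ico (h i) (h j))) (subPred P (Set.Ico (h i) (h j)))
      (subRel (· < ·) (Set.Ico (h i') (h j'))) (subPred P (Set.Ico (h i') (h j')))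

/-- `H = {h 0 < h 1 < ⋯}` is uniformly homogeneous for `(ℕ, <, P)`:
for each `k`, the set `{h k < h (k+1) < ⋯}` is `k`-homogeneous. -/
def UniformlyHomogeneous {n : ℕ} (P : Fin n → Set ℕ) (h : ℕ → ℕ) : Prop :=
  StrictMono h ∧
  ∀ k : ℕ, KHomogeneous P (fun i => h (k + i)) k

/-! ## ℤ-words -/

/-- The finite word `u` occurs at position `i` in the `ℤ`-word `w`. -/
def OccursAt {σ : Type} (w : ℤ → σ) (u : List σ) (i : ℤ) : Prop :=
  ∀ k : Fin u.length, w (i + (k : ℕ)) = u.get k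

/-- The finite word `u` occurs in the `ℤ`-word `w`. -/
def OccursIn {σ : Type} (w : ℤ → σ) (u : List σ) : Prop :=
  ∃ i : ℤ, OccursAt w u i

/-- `u` occurs in every prefix of `w`. -/
def InEveryPrefix {σ : Type} (w : ℤ → σ) (u : List σ) : Prop :=
  ∀ n : ℤ, ∃ i : ℤ, i + u.length ≤ n ∧ OccursAt w u i

/-- `u` occurs in every suffix of `w`. -/
def InEverySuffix {σ : Type} (w : ℤ → σ) (u : List σ) : Prop :=
  ∀ n : ℤ, ∃ i : ℤ, n ≤ i ∧ OccursAt w u i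

/-- A `ℤ`-word `w` is recurrent: for every regular language `X`, either no element
of `X` occurs in `w`, or every prefix and every suffix of `w` contains an
occurrence of some element of `X`. -/
def Recurrent {σ : Type} (w : ℤ → σ) : Prop :=
  ∀ X : Language σ, X.IsRegular →
    (∀ u ∈ X, ¬ OccursIn w u) ∨
    (∀ n : ℤ, (∃ u ∈ X, ∃ i : ℤ, i + u.length ≤ n ∧ OccursAt w u i) ∧
              (∃ u ∈ X, ∃ i : ℤ, n ≤ i ∧ OccursAt w u i))

/-- The `ℤ`-word `w(M)` over the alphabet `{0,1}ⁿ` associated with the labelled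
linear ordering `M = (ℤ, <, P₁, …, Pₙ)`. -/
def wordOf {n : ℕ} (P : Fin n → Set ℤ) : ℤ → (Fin n → Prop) :=
  fun i k => i ∈ P k

end Paper

open Paper

namespace Paper
namespace MSO

variable {n : ℕ}

/-- The finite type of possible `φ`-types of a segment of a labelled ordering. -/
def SegType : MSO n → Type
  | lt _ _ => Prop × Prop × Prop
  | pred _ _ => Prop
  | mem _ _ => Prop
  | not φ => SegType φ
  | and φ ψ => SegType φ × SegType ψ
  | ex1 _ φ => SegType φ × Set (SegType φ)
  | ex2 _ φ => Set (SegType φ)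

/-- The `φ`-type of the segment `[a, b)`.  First-order variables are interpreted by the sets `F i`,
which are singletons or empty according to whether the variable lies in the segment. -/
def segType (P : Fin n → Set ℕ) :
    (φ : MSO n) → (F V : ℕ → Set ℕ) → ℕ → ℕ → SegType φ
  | lt i j, F, _, a, b =>
      (∃ x ∈ Set.Ico a b, x ∈ F i, ∃ x ∈ Set.Ico a b, x ∈ F j,
        ∃ x ∈ Set.Ico a b, ∃ y ∈ Set.Ico a b, x ∈ F i ∧ y ∈ F j ∧ x < y)
  | pred k i, F, _, a, b => ∃ x ∈ Set.Ico a b, x ∈ F i ∧ x ∈ P k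
  | mem i j, F, V, a, b => ∃ x ∈ Set.Ico a b, x ∈ F i ∧ x ∈ V j
  | not φ, F, V, a, b => segType P φ F V a b
  | and φ ψ, F, V, a, b => (segType P φ F V a b, segType P ψ F V a b)
  | ex1 i φ, F, V, a, b =>
      (segType P φ (Function.update F i ∅) V a b,
        {s | ∃ x ∈ Set.Ico a b, segType P φ (Function.update F i {x}) V a b = s})
  | ex2 j φ, F, V, a, b => {s | ∃ X, segType P φ F (Function.update V j X) a b = s}

/-- Composition of the types of two adjacent segments. -/
def SegType.comp : (φ : MSO n) → SegType φ → SegType φ → SegType φ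
  | lt _ _, s, t => (s.1 ∨ t.1, s.2.1 ∨ t.2.1, s.2.2 ∨ t.2.2 ∨ s.1 ∧ t.2.1)
  | pred _ _, s, t => Or s t
  | mem _ _, s, t => Or s t
  | not φ, s, t => SegType.comp φ s t
  | and φ ψ, s, t => (SegType.comp φ s.1 t.1, SegType.comp ψ s.2 t.2)
  | ex1 _ φ, s, t =>
      (SegType.comp φ s.1 t.1,
        {u | (∃ x ∈ s.2, SegType.comp φ x t.1 = u) ∨ ∃ x ∈ t.2, SegType.comp φ s.1 x = u})
  | ex2 _ φ, s, t => Set.image2 (SegType.comp φ) s t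

instance SegType.finite : (φ : MSO n) → Finite (SegType φ)
  | lt _ _ => inferInstanceAs (Finite (Prop × Prop × Prop))
  | pred _ _ => inferInstanceAs (Finite Prop)
  | mem _ _ => inferInstanceAs (Finite Prop)
  | not φ => SegType.finite φ
  | and φ ψ =>
      have := SegType.finite φ
      have := SegType.finite ψ
      inferInstanceAs (Finite (SegType φ × SegType ψ))
  | ex1 _ φ =>
      have := SegType.finite φ
      inferInstanceAs (Finite (SegType φ × Set (SegType φ)))
  | ex2 _ φ =>
      have := SegType.finite φ
      inferInstanceAs (Finite (Set (SegType φ)))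

/-- An iterated exponential bounding the number of types in terms of the Gödel number. -/
def typeBound : ℕ → ℕ
  | 0 => 8
  | c + 1 => 2 ^ (2 * typeBound c)

theorem typeBound_lt_succ (c : ℕ) : typeBound c < typeBound (c + 1) := by
  have : 2 * typeBound c < 2 ^ (2 * typeBound c) := Nat.lt_two_pow_self
  rw [typeBound]; omega

theorem typeBound_mono : Monotone typeBound :=
  monotone_nat_of_le_succ fun c => (typeBound_lt_succ c).le

theorem eight_le_typeBound (c : ℕ) : 8 ≤ typeBound c :=
  typeBound_mono (Nat.zero_le c)

theorem lt_pair_of_pos {a : ℕ} (ha : 0 < a) (b : ℕ) : b < Nat.pair a b :=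
  lt_of_lt_of_le (by omega) (Nat.add_le_pair a b)

theorem encode_lt_not (φ : MSO n) : encode φ < encode (not φ) :=
  lt_pair_of_pos (by norm_num) _

theorem encode_lt_and_left (φ ψ : MSO n) : encode φ < encode (and φ ψ) :=
  (Nat.left_le_pair _ _).trans_lt (lt_pair_of_pos (by norm_num) _)

theorem encode_lt_and_right (φ ψ : MSO n) : encode ψ < encode (and φ ψ) :=
  (Nat.right_le_pair _ _).trans_lt (lt_pair_of_pos (by norm_num) _)

theorem encode_lt_ex1 (i : ℕ) (φ : MSO n) : encode φ < encode (ex1 i φ) :=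
  (Nat.right_le_pair _ _).trans_lt (lt_pair_of_pos (by norm_num) _)

theorem encode_lt_ex2 (j : ℕ) (φ : MSO n) : encode φ < encode (ex2 j φ) :=
  (Nat.right_le_pair _ _).trans_lt (lt_pair_of_pos (by norm_num) _)

theorem qd_le_encode (φ : MSO n) : qd φ ≤ encode φ := by
  induction φ with
  | lt | pred | mem => exact Nat.zero_le _
  | not φ ih => exact ih.trans (encode_lt_not φ).le
  | and φ ψ ih₁ ih₂ =>
    exact max_le (ih₁.trans (encode_lt_and_left φ ψ).le) (ih₂.trans (encode_lt_and_right φ ψ).le)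
  | ex1 i φ ih => exact (Nat.succ_le_succ ih).trans (encode_lt_ex1 i φ)
  | ex2 j φ ih => exact (Nat.succ_le_succ ih).trans (encode_lt_ex2 j φ)

theorem typeBound_of_lt {a b : ℕ} (h : a < b) : 2 ^ (2 * typeBound a) ≤ typeBound b :=
  typeBound_mono (Nat.succ_le_of_lt h)

theorem card_segType_le (φ : MSO n) : Nat.card (SegType φ) ≤ typeBound (encode φ) := by
  have card_set (α : Type) [Finite α] : Nat.card (Set α) = 2 ^ Nat.card α := by
    have := Fintype.ofFinite α
    simp
  induction φ with
  | lt i j =>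
    refine le_trans (le_of_eq ?_) (eight_le_typeBound _)
    change Nat.card (Prop × Prop × Prop) = 8
    simp
  | pred k i =>
    refine le_trans (le_of_eq ?_) ((by norm_num : 2 ≤ 8).trans (eight_le_typeBound _))
    change Nat.card Prop = 2
    simp
  | mem i j =>
    refine le_trans (le_of_eq ?_) ((by norm_num : 2 ≤ 8).trans (eight_le_typeBound _))
    change Nat.card Prop = 2
    simp
  | not φ ih => exact ih.trans (typeBound_mono (encode_lt_not φ).le)
  | and φ ψ ih₁ ih₂ =>
    change Nat.card (SegType φ × SegType ψ) ≤ _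
    rw [Nat.card_prod]
    have hmax : max (encode φ) (encode ψ) < encode (and φ ψ) :=
      max_lt (encode_lt_and_left φ ψ) (encode_lt_and_right φ ψ)
    refine le_trans ?_ (typeBound_of_lt hmax)
    rw [two_mul, pow_add]
    exact Nat.mul_le_mul
      ((ih₁.trans (typeBound_mono (le_max_left _ _))).trans Nat.lt_two_pow_self.le)
      ((ih₂.trans (typeBound_mono (le_max_right _ _))).trans Nat.lt_two_pow_self.le)
  | ex1 i φ ih =>
    change Nat.card (SegType φ × Set (SegType φ)) ≤ _
    rw [Nat.card_prod, card_set]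
    refine le_trans ?_ (typeBound_of_lt (encode_lt_ex1 i φ))
    rw [two_mul, pow_add]
    exact Nat.mul_le_mul (ih.trans Nat.lt_two_pow_self.le) (Nat.pow_le_pow_right two_pos ih)
  | ex2 j φ ih =>
    change Nat.card (Set (SegType φ)) ≤ _
    rw [card_set]
    refine le_trans ?_ (typeBound_of_lt (encode_lt_ex2 j φ))
    exact Nat.pow_le_pow_right two_pos (by omega)

theorem mem_update_iff {F F' : ℕ → Set ℕ} {X X' : Set ℕ} {x x' : ℕ} (i : ℕ)
    (hF : ∀ j, x ∈ F j ↔ x' ∈ F' j) (hX : x ∈ X ↔ x' ∈ X') (j : ℕ) :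
    x ∈ Function.update F i X j ↔ x' ∈ Function.update F' i X' j := by
  by_cases hj : j = i
  · subst hj; simpa using hX
  · simpa [hj] using hF j

theorem exists_mem_Ico_congr {Q Q' : ℕ → Prop} {a a' L : ℕ}
    (h : ∀ x < L, Q (a + x) ↔ Q' (a' + x)) :
    (∃ x ∈ Set.Ico a (a + L), Q x) ↔ ∃ x ∈ Set.Ico a' (a' + L), Q' x := by
  have shift {Q : ℕ → Prop} {a : ℕ} :
      (∃ x ∈ Set.Ico a (a + L), Q x) ↔ ∃ x < L, Q (a + x) := by
    constructor
    · rintro ⟨x, ⟨h₁, h₂⟩, hx⟩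
      exact ⟨x - a, by omega, by rwa [Nat.add_sub_cancel' h₁]⟩
    · rintro ⟨x, h, hx⟩
      exact ⟨a + x, ⟨by omega, by omega⟩, hx⟩
  rw [shift, shift]
  exact exists_congr fun x => and_congr_right fun hx => h x hx

/-- The type of a segment depends only on the isomorphism type of the labelled segment. -/
theorem segType_congr (φ : MSO n) : ∀ {P P' : Fin n → Set ℕ} {F V F' V' : ℕ → Set ℕ} {a a' L : ℕ},
    (∀ x < L, ∀ k, a + x ∈ P k ↔ a' + x ∈ P' k) →
    (∀ x < L, ∀ i, a + x ∈ F i ↔ a' + x ∈ F' i) →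
    (∀ x < L, ∀ j, a + x ∈ V j ↔ a' + x ∈ V' j) →
    segType P φ F V a (a + L) = segType P' φ F' V' a' (a' + L) := by
  induction φ with
  | lt i j =>
    intro P P' F V F' V' a a' L _ hF _
    refine Prod.ext (propext (exists_mem_Ico_congr fun x hx => hF x hx i))
      (Prod.ext (propext (exists_mem_Ico_congr fun x hx => hF x hx j))
        (propext (exists_mem_Ico_congr fun x hx => exists_mem_Ico_congr fun y hy => ?_)))
    rw [hF x hx i, hF y hy j, Nat.add_lt_add_iff_left, Nat.add_lt_add_iff_left]
  | pred k i =>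
    intro P P' F V F' V' a a' L hP hF _
    exact propext (exists_mem_Ico_congr fun x hx => and_congr (hF x hx i) (hP x hx k))
  | mem i j =>
    intro P P' F V F' V' a a' L _ hF hV
    exact propext (exists_mem_Ico_congr fun x hx => and_congr (hF x hx i) (hV x hx j))
  | not φ ih => exact ih
  | and φ ψ ih₁ ih₂ =>
    intro P P' F V F' V' a a' L hP hF hV
    exact Prod.ext (ih₁ hP hF hV) (ih₂ hP hF hV)
  | ex1 i φ ih =>
    intro P P' F V F' V' a a' L hP hF hV
    refine Prod.ext (ih hP (fun x hx => mem_update_iff i (hF x hx) (by simp)) hV) ?_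
    refine Set.ext fun s => exists_mem_Ico_congr fun x hx => ?_
    rw [ih (F' := Function.update F' i {a' + x}) hP
      (fun y hy => mem_update_iff i (hF y hy) (by simp)) hV]
  | ex2 j φ ih =>
    intro P P' F V F' V' a a' L hP hF hV
    refine Set.ext fun s => ?_
    constructor
    · rintro ⟨X, rfl⟩
      refine ⟨{z | a + (z - a') ∈ X}, (ih hP hF fun x hx => mem_update_iff j (hV x hx) ?_).symm⟩
      simp
    · rintro ⟨X, rfl⟩
      refine ⟨{z | a' + (z - a) ∈ X}, ih hP hF fun x hx => mem_update_iff j (hV x hx) ?_⟩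
      simp

theorem segType_local (φ : MSO n) (P : Fin n → Set ℕ) {F V F' V' : ℕ → Set ℕ} {a b : ℕ}
    (hab : a ≤ b) (hF : ∀ x ∈ Set.Ico a b, ∀ i, x ∈ F i ↔ x ∈ F' i)
    (hV : ∀ x ∈ Set.Ico a b, ∀ j, x ∈ V j ↔ x ∈ V' j) :
    segType P φ F V a b = segType P φ F' V' a b := by
  obtain ⟨L, rfl⟩ := Nat.exists_eq_add_of_le hab
  exact segType_congr φ (fun _ _ _ => Iff.rfl) (fun x hx => hF _ ⟨by omega, by omega⟩)
    (fun x hx => hV _ ⟨by omega, by omega⟩)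

theorem exists_mem_Ico_split {Q : ℕ → Prop} {a b c : ℕ} (hab : a ≤ b) (hbc : b ≤ c) :
    (∃ x ∈ Set.Ico a c, Q x) ↔ (∃ x ∈ Set.Ico a b, Q x) ∨ ∃ x ∈ Set.Ico b c, Q x := by
  rw [← Set.Ico_union_Ico_eq_Ico hab hbc]
  simp only [Set.mem_union, or_and_right, exists_or]

/-- The type of a segment is the composition of the types of its two parts. -/
theorem segType_comp (φ : MSO n) (P : Fin n → Set ℕ) : ∀ {F V : ℕ → Set ℕ} {a b c : ℕ},
    a ≤ b → b ≤ c →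
    segType P φ F V a c = SegType.comp φ (segType P φ F V a b) (segType P φ F V b c) := by
  induction φ with
  | lt i j =>
    intro F V a b c hab hbc
    refine Prod.ext (propext (exists_mem_Ico_split hab hbc))
      (Prod.ext (propext (exists_mem_Ico_split hab hbc)) (propext ?_))
    change _ ↔ _ ∨ _ ∨ (_ ∧ _)
    constructor
    · rintro ⟨x, hx, y, hy, hxi, hyj, hxy⟩
      rcases lt_or_ge x b with h₁ | h₁ <;> rcases lt_or_ge y b with h₂ | h₂
      · exact Or.inl ⟨x, ⟨hx.1, h₁⟩, y, ⟨hy.1, h₂⟩, hxi, hyj, hxy⟩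
      · exact Or.inr (Or.inr ⟨⟨x, ⟨hx.1, h₁⟩, hxi⟩, y, ⟨h₂, hy.2⟩, hyj⟩)
      · omega
      · exact Or.inr (Or.inl ⟨x, ⟨h₁, hx.2⟩, y, ⟨h₂, hy.2⟩, hxi, hyj, hxy⟩)
    · rintro (⟨x, hx, y, hy, h⟩ | ⟨x, hx, y, hy, h⟩ | ⟨⟨x, hx, hxi⟩, y, hy, hyj⟩)
      · exact ⟨x, ⟨hx.1, hx.2.trans_le hbc⟩, y, ⟨hy.1, hy.2.trans_le hbc⟩, h⟩
      · exact ⟨x, ⟨hab.trans hx.1, hx.2⟩, y, ⟨hab.trans hy.1, hy.2⟩, h⟩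
      · exact ⟨x, ⟨hx.1, hx.2.trans_le hbc⟩, y, ⟨hab.trans hy.1, hy.2⟩, hxi, hyj,
          hx.2.trans_le hy.1⟩
  | pred k i =>
    intro F V a b c hab hbc
    exact propext (exists_mem_Ico_split hab hbc)
  | mem i j =>
    intro F V a b c hab hbc
    exact propext (exists_mem_Ico_split hab hbc)
  | not φ ih => exact ih
  | and φ ψ ih₁ ih₂ =>
    intro F V a b c hab hbc
    exact Prod.ext (ih₁ hab hbc) (ih₂ hab hbc)
  | ex1 i φ ih =>
    intro F V a b c hab hbc
    refine Prod.ext (ih hab hbc) ?_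
    have left {x : ℕ} (hx : x ∈ Set.Ico a b) :
        segType P φ (Function.update F i {x}) V b c = segType P φ (Function.update F i ∅) V b c :=
      segType_local φ P hbc (fun y hy => mem_update_iff i (fun _ => Iff.rfl)
        (by have := hx.2; have := hy.1; simp; omega)) fun _ _ _ => Iff.rfl
    have right {x : ℕ} (hx : x ∈ Set.Ico b c) :
        segType P φ (Function.update F i {x}) V a b = segType P φ (Function.update F i ∅) V a b :=
      segType_local φ P hab (fun y hy => mem_update_iff i (fun _ => Iff.rfl)
        (by have := hx.1; have := hy.2; simp; omega)) fun _ _ _ => Iff.rfl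
    refine Set.ext fun s => ?_
    refine (exists_mem_Ico_split hab hbc).trans (or_congr ?_ ?_)
    · constructor
      · rintro ⟨x, hx, rfl⟩
        exact ⟨_, ⟨x, hx, rfl⟩, by rw [ih hab hbc, left hx]; rfl⟩
      · rintro ⟨_, ⟨x, hx, rfl⟩, rfl⟩
        exact ⟨x, hx, by rw [ih hab hbc, left hx]; rfl⟩
    · constructor
      · rintro ⟨x, hx, rfl⟩
        exact ⟨_, ⟨x, hx, rfl⟩, by rw [ih hab hbc, right hx]; rfl⟩
      · rintro ⟨_, ⟨x, hx, rfl⟩, rfl⟩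
        exact ⟨x, hx, by rw [ih hab hbc, right hx]; rfl⟩
  | ex2 j φ ih =>
    intro F V a b c hab hbc
    refine Set.ext fun s => ?_
    constructor
    · rintro ⟨X, rfl⟩
      exact ⟨_, ⟨X, rfl⟩, _, ⟨X, rfl⟩, (ih hab hbc).symm⟩
    · rintro ⟨_, ⟨X, rfl⟩, _, ⟨Y, rfl⟩, rfl⟩
      refine ⟨{x | x < b ∧ x ∈ X ∨ b ≤ x ∧ x ∈ Y}, (ih hab hbc).trans (congrArg₂ _ ?_ ?_)⟩
      · refine segType_local φ P hab (fun _ _ _ => Iff.rfl) fun x hx =>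
          mem_update_iff j (fun _ => Iff.rfl) ?_
        have := hx.2
        simp [this]
      · refine segType_local φ P hbc (fun _ _ _ => Iff.rfl) fun x hx =>
          mem_update_iff j (fun _ => Iff.rfl) ?_
        have := hx.1
        simp [this]

/-- The singletons of a first-order assignment. -/
def singles (v : ℕ → ℕ) : ℕ → Set ℕ := fun i => {v i}

theorem singles_update (v : ℕ → ℕ) (i x : ℕ) :
    singles (Function.update v i x) = Function.update (singles v) i {x} := by
  funext j
  by_cases hj : j = i
  · subst hj; simp [singles]
  · simp [singles, hj]

theorem exists_segment {t : ℕ → ℕ} (ht : StrictMono t) (h0 : t 0 = 0) (x : ℕ) :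
    ∃ a, x ∈ Set.Ico (t a) (t (a + 1)) := by
  induction x with
  | zero => exact ⟨0, h0.le, by simpa [h0] using ht (Nat.zero_lt_one)⟩
  | succ x ih =>
    obtain ⟨a, h₁, h₂⟩ := ih
    rcases (Nat.succ_le_of_lt h₂).lt_or_eq with h | h
    · exact ⟨a, h₁.trans (Nat.le_succ x), h⟩
    · exact ⟨a + 1, h.ge, by rw [← Nat.succ_eq_add_one, h]; exact ht (Nat.lt_succ_self _)⟩

theorem segment_le {t : ℕ → ℕ} (ht : StrictMono t) {a b x y : ℕ}
    (hx : x ∈ Set.Ico (t a) (t (a + 1))) (hy : y ∈ Set.Ico (t b) (t (b + 1))) (hxy : x ≤ y) :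
    a ≤ b :=
  Nat.lt_succ_iff.1 (ht.lt_iff_lt.1 (hx.1.trans_lt (hxy.trans_lt hy.2)))

/-- Truth in an `ω`-sum is determined by the types of the summands. -/
theorem sat_iff_of_segType_eq (φ : MSO n) :
    ∀ {P P' : Fin n → Set ℕ} {v v' : ℕ → ℕ} {V V' : ℕ → Set ℕ} {t t' : ℕ → ℕ},
    StrictMono t → StrictMono t' → t 0 = 0 → t' 0 = 0 →
    (∀ a, segType P φ (singles v) V (t a) (t (a + 1)) =
      segType P' φ (singles v') V' (t' a) (t' (a + 1))) →
    (Sat (fun x y : ℕ => x < y) P v V φ ↔ Sat (fun x y : ℕ => x < y) P' v' V' φ) := by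
  induction φ with
  | lt i j =>
    have key : ∀ {P P' : Fin n → Set ℕ} {v v' : ℕ → ℕ} {V V' : ℕ → Set ℕ} {t t' : ℕ → ℕ},
        StrictMono t → StrictMono t' → t 0 = 0 → t' 0 = 0 →
        (∀ a, segType P (lt i j) (singles v) V (t a) (t (a + 1)) =
          segType P' (lt i j) (singles v') V' (t' a) (t' (a + 1))) → v i < v j → v' i < v' j := by
      intro P P' v v' V V' t t' ht ht' h0 h0' h hlt
      obtain ⟨a, ha⟩ := exists_segment ht h0 (v i)
      obtain ⟨b, hb⟩ := exists_segment ht h0 (v j)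
      obtain ⟨x, hx, rfl⟩ := (congrArg Prod.fst (h a)).mp ⟨v i, ha, rfl⟩
      obtain ⟨y, hy, rfl⟩ := (congrArg (fun s => s.2.1) (h b)).mp ⟨v j, hb, rfl⟩
      rcases (segment_le ht ha hb hlt.le).lt_or_eq with hab | rfl
      · exact hx.2.trans_le ((ht'.monotone hab).trans hy.1)
      · obtain ⟨x, hx, y, hy, rfl, rfl, hxy⟩ :=
          (congrArg (fun s => s.2.2) (h a)).mp ⟨v i, ha, v j, hb, rfl, rfl, hlt⟩
        exact hxy
    intro P P' v v' V V' t t' ht ht' h0 h0' h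
    exact ⟨key ht ht' h0 h0' h, key ht' ht h0' h0 fun a => (h a).symm⟩
  | pred k i =>
    have key : ∀ {P P' : Fin n → Set ℕ} {v v' : ℕ → ℕ} {V V' : ℕ → Set ℕ} {t t' : ℕ → ℕ},
        StrictMono t → t 0 = 0 →
        (∀ a, segType P (pred k i) (singles v) V (t a) (t (a + 1)) =
          segType P' (pred k i) (singles v') V' (t' a) (t' (a + 1))) → v i ∈ P k → v' i ∈ P' k := by
      intro P P' v v' V V' t t' ht h0 h hi
      obtain ⟨a, ha⟩ := exists_segment ht h0 (v i)
      obtain ⟨x, hx, rfl, hk⟩ := (h a).mp ⟨v i, ha, rfl, hi⟩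
      exact hk
    intro P P' v v' V V' t t' ht ht' h0 h0' h
    exact ⟨key ht h0 h, key ht' h0' fun a => (h a).symm⟩
  | mem i j =>
    have key : ∀ {P P' : Fin n → Set ℕ} {v v' : ℕ → ℕ} {V V' : ℕ → Set ℕ} {t t' : ℕ → ℕ},
        StrictMono t → t 0 = 0 →
        (∀ a, segType P (mem i j) (singles v) V (t a) (t (a + 1)) =
          segType P' (mem i j) (singles v') V' (t' a) (t' (a + 1))) → v i ∈ V j → v' i ∈ V' j := by
      intro P P' v v' V V' t t' ht h0 h hi
      obtain ⟨a, ha⟩ := exists_segment ht h0 (v i)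
      obtain ⟨x, hx, rfl, hk⟩ := (h a).mp ⟨v i, ha, rfl, hi⟩
      exact hk
    intro P P' v v' V V' t t' ht ht' h0 h0' h
    exact ⟨key ht h0 h, key ht' h0' fun a => (h a).symm⟩
  | not φ ih =>
    intro P P' v v' V V' t t' ht ht' h0 h0' h
    exact not_congr (ih ht ht' h0 h0' h)
  | and φ ψ ih₁ ih₂ =>
    intro P P' v v' V V' t t' ht ht' h0 h0' h
    exact and_congr (ih₁ ht ht' h0 h0' fun a => congrArg Prod.fst (h a))
      (ih₂ ht ht' h0 h0' fun a => congrArg Prod.snd (h a))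
  | ex1 i φ ih =>
    have key : ∀ {P P' : Fin n → Set ℕ} {v v' : ℕ → ℕ} {V V' : ℕ → Set ℕ} {t t' : ℕ → ℕ},
        StrictMono t → StrictMono t' → t 0 = 0 → t' 0 = 0 →
        (∀ a, segType P (ex1 i φ) (singles v) V (t a) (t (a + 1)) =
          segType P' (ex1 i φ) (singles v') V' (t' a) (t' (a + 1))) →
        Sat (fun x y : ℕ => x < y) P v V (ex1 i φ) →
        Sat (fun x y : ℕ => x < y) P' v' V' (ex1 i φ) := by
      rintro P P' v v' V V' t t' ht ht' h0 h0' h ⟨x, hsat⟩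
      obtain ⟨a, ha⟩ := exists_segment ht h0 x
      have hmem : segType P φ (Function.update (singles v) i {x}) V (t a) (t (a + 1)) ∈
          (segType P' (ex1 i φ) (singles v') V' (t' a) (t' (a + 1))).2 := by
        rw [← h a]
        exact ⟨x, ha, rfl⟩
      obtain ⟨x', ha', hx'⟩ := hmem
      refine ⟨x', (ih ht ht' h0 h0' fun b => ?_).1 hsat⟩
      rw [singles_update, singles_update]
      by_cases hb : b = a
      · subst hb; exact hx'.symm
      · have off {s : ℕ → ℕ} (hs : StrictMono s) {Q : Fin n → Set ℕ} {F U : ℕ → Set ℕ} {z : ℕ}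
            (hz : z ∈ Set.Ico (s a) (s (a + 1))) :
            segType Q φ (Function.update F i {z}) U (s b) (s (b + 1)) =
              segType Q φ (Function.update F i ∅) U (s b) (s (b + 1)) := by
          refine segType_local φ Q (hs (Nat.lt_succ_self b)).le (fun y hy =>
            mem_update_iff i (fun _ => Iff.rfl) ?_) fun _ _ _ => Iff.rfl
          simp only [Set.mem_singleton_iff, Set.mem_empty_iff_false, iff_false]
          rintro rfl
          exact hb (le_antisymm (segment_le hs hy hz le_rfl) (segment_le hs hz hy le_rfl))
        rw [off ht ha, off ht' ha']
        exact congrArg Prod.fst (h b)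
    intro P P' v v' V V' t t' ht ht' h0 h0' h
    exact ⟨key ht ht' h0 h0' h, key ht' ht h0' h0 fun a => (h a).symm⟩
  | ex2 j φ ih =>
    have key : ∀ {P P' : Fin n → Set ℕ} {v v' : ℕ → ℕ} {V V' : ℕ → Set ℕ} {t t' : ℕ → ℕ},
        StrictMono t → StrictMono t' → t 0 = 0 → t' 0 = 0 →
        (∀ a, segType P (ex2 j φ) (singles v) V (t a) (t (a + 1)) =
          segType P' (ex2 j φ) (singles v') V' (t' a) (t' (a + 1))) →
        Sat (fun x y : ℕ => x < y) P v V (ex2 j φ) →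
        Sat (fun x y : ℕ => x < y) P' v' V' (ex2 j φ) := by
      rintro P P' v v' V V' t t' ht ht' h0 h0' h ⟨X, hsat⟩
      have hmem (a : ℕ) : ∃ Y, segType P' φ (singles v') (Function.update V' j Y)
          (t' a) (t' (a + 1)) = segType P φ (singles v) (Function.update V j X) (t a) (t (a + 1)) :=
        (Set.ext_iff.1 (h a) _).1 ⟨X, rfl⟩
      choose Y hY using hmem
      refine ⟨{x | ∃ a, x ∈ Set.Ico (t' a) (t' (a + 1)) ∧ x ∈ Y a},
        (ih ht ht' h0 h0' fun a => (hY a).symm.trans ?_).1 hsat⟩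
      refine segType_local φ P' (ht' (Nat.lt_succ_self a)).le (fun _ _ _ => Iff.rfl) fun x hx =>
        mem_update_iff j (fun _ => Iff.rfl) ⟨fun hxY => ⟨a, hx, hxY⟩, ?_⟩
      rintro ⟨b, hb, hxY⟩
      rwa [le_antisymm (segment_le ht' hx hb le_rfl) (segment_le ht' hb hx le_rfl)]
    intro P P' v v' V V' t t' ht ht' h0 h0' h
    exact ⟨key ht ht' h0 h0' h, key ht' ht h0' h0 fun a => (h a).symm⟩

end MSO
end Paper

namespace Paper
namespace MSO

variable {n : ℕ}

theorem sat_congr {A : Type} {r : A → A → Prop} {P : Fin n → Set A} (φ : MSO n) :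
    ∀ {v v' : ℕ → A} {V V' : ℕ → Set A}, (∀ i ∈ fv1 φ, v i = v' i) → (∀ j ∈ fv2 φ, V j = V' j) →
    (Sat r P v V φ ↔ Sat r P v' V' φ) := by
  induction φ with
  | lt i j =>
    intro v v' V V' hv _
    simp [Sat, hv i (by simp [fv1]), hv j (by simp [fv1])]
  | pred k i =>
    intro v v' V V' hv _
    simp [Sat, hv i (by simp [fv1])]
  | mem i j =>
    intro v v' V V' hv hV
    simp [Sat, hv i (by simp [fv1]), hV j (by simp [fv2])]
  | not φ ih =>
    intro v v' V V' hv hV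
    exact not_congr (ih hv hV)
  | and φ ψ ih₁ ih₂ =>
    intro v v' V V' hv hV
    exact and_congr
      (ih₁ (fun i hi => hv i (Finset.mem_union_left _ hi))
        (fun j hj => hV j (Finset.mem_union_left _ hj)))
      (ih₂ (fun i hi => hv i (Finset.mem_union_right _ hi))
        (fun j hj => hV j (Finset.mem_union_right _ hj)))
  | ex1 i φ ih =>
    intro v v' V V' hv hV
    refine exists_congr fun a => ih (fun l hl => ?_) hV
    by_cases hli : l = i
    · subst hli; simp
    · simpa [hli] using hv l (by simp [fv1, hl, hli])
  | ex2 j φ ih =>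
    intro v v' V V' hv hV
    refine exists_congr fun X => ih hv fun l hl => ?_
    by_cases hlj : l = j
    · subst hlj; simp
    · simpa [hlj] using hV l (by simp [fv2, hl, hlj])

theorem trueIn_iff_sat {A : Type} {r : A → A → Prop} {P : Fin n → Set A} {φ : MSO n}
    (hφ : IsSentence φ) (v : ℕ → A) (V : ℕ → Set A) : TrueIn r P φ ↔ Sat r P v V φ :=
  ⟨fun h => h v V, fun h _ _ =>
    (sat_congr φ (by simp [hφ.1]) (by simp [hφ.2])).1 h⟩

/-- A property of segments `[a, b)` of a labelled ordering, equipped with a set assignment. -/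
abbrev SegProp (n : ℕ) : Type :=
  (Fin n → Set ℕ) → (a b : ℕ) → (ℕ → Set (Set.Ico a b)) → Prop

/-- The property `Q` of segments is expressed by an MSO formula of quantifier depth at most `k`,
all of whose free variables are set variables with indices in `A`. -/
def Expressible (k : ℕ) (A : Set ℕ) (Q : SegProp n) : Prop :=
  ∃ χ : MSO n, qd χ ≤ k ∧ fv1 χ = ∅ ∧ (∀ l ∈ fv2 χ, l ∈ A) ∧
    ∀ P a b v W, a ≤ b →
      (Sat (subRel (· < ·) (Set.Ico a b)) (subPred P (Set.Ico a b)) v W χ ↔ Q P a b W)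

namespace Expressible

variable {k : ℕ} {A : Set ℕ} {Q R : SegProp n}

theorem of_iff (hQ : Expressible k A Q) (h : ∀ P a b W, a ≤ b → (Q P a b W ↔ R P a b W)) :
    Expressible k A R := by
  obtain ⟨χ, h₁, h₂, h₃, h₄⟩ := hQ
  exact ⟨χ, h₁, h₂, h₃, fun P a b v W hab => (h₄ P a b v W hab).trans (h P a b W hab)⟩

theorem mono {k' : ℕ} {A' : Set ℕ} (hQ : Expressible k A Q) (hk : k ≤ k') (hA : A ⊆ A') :
    Expressible k' A' Q := by
  obtain ⟨χ, h₁, h₂, h₃, h₄⟩ := hQ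
  exact ⟨χ, h₁.trans hk, h₂, fun l hl => hA (h₃ l hl), h₄⟩

theorem compl (hQ : Expressible k A Q) : Expressible k A fun P a b W => ¬ Q P a b W := by
  obtain ⟨χ, h₁, h₂, h₃, h₄⟩ := hQ
  exact ⟨MSO.not χ, h₁, h₂, h₃, fun P a b v W hab => not_congr (h₄ P a b v W hab)⟩

theorem inter (hQ : Expressible k A Q) (hR : Expressible k A R) :
    Expressible k A fun P a b W => Q P a b W ∧ R P a b W := by
  obtain ⟨χ, h₁, h₂, h₃, h₄⟩ := hQ
  obtain ⟨ψ, g₁, g₂, g₃, g₄⟩ := hR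
  refine ⟨MSO.and χ ψ, max_le h₁ g₁, by simp [fv1, h₂, g₂], fun l hl => ?_,
    fun P a b v W hab => and_congr (h₄ P a b v W hab) (g₄ P a b v W hab)⟩
  rcases Finset.mem_union.1 hl with hl | hl
  · exact h₃ l hl
  · exact g₃ l hl

theorem iff_const (hQ : Expressible k A Q) (p : Prop) :
    Expressible k A fun P a b W => (Q P a b W ↔ p) := by
  by_cases hp : p
  · exact hQ.of_iff fun P a b W _ => by simp [hp]
  · exact hQ.compl.of_iff fun P a b W _ => by simp [hp]

theorem verum (k : ℕ) (A : Set ℕ) : Expressible (k + 1) A fun (_ : Fin n → Set ℕ) _ _ _ => True := by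
  refine ⟨MSO.not (ex1 0 (lt 0 0)), by simp [qd], by simp [fv1], by simp [fv2], ?_⟩
  intro P a b v W _
  simp [Sat, subRel]

theorem forall_finite {ι : Type} [Finite ι] {Q : ι → SegProp n}
    (hQ : ∀ i, Expressible (k + 1) A (Q i)) :
    Expressible (k + 1) A fun P a b W => ∀ i, Q i P a b W := by
  classical
  have := Fintype.ofFinite ι
  have key (s : Finset ι) : Expressible (k + 1) A fun P a b W => ∀ i ∈ s, Q i P a b W := by
    induction s using Finset.induction_on with
    | empty => exact (verum k A).of_iff fun P a b W _ => by simp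
    | insert i s _ ih => exact ((hQ i).inter ih).of_iff fun P a b W _ => by simp
  exact (key Finset.univ).of_iff fun P a b W _ => by simp

theorem exists_set {A' : Set ℕ} (l : ℕ) (hQ : Expressible k A' Q) (hA : A' ⊆ insert l A) :
    Expressible (k + 1) A fun P a b W => ∃ X, Q P a b (Function.update W l X) := by
  obtain ⟨χ, h₁, h₂, h₃, h₄⟩ := hQ
  refine ⟨ex2 l χ, Nat.succ_le_succ h₁, h₂, fun m hm => ?_,
    fun P a b v W hab => exists_congr fun X => h₄ P a b v _ hab⟩
  obtain ⟨hm, hml⟩ := Finset.mem_sdiff.1 hm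
  exact (hA (h₃ m hm)).resolve_left (by simpa using hml)

theorem nonempty {l : ℕ} (hl : l ∈ A) :
    Expressible (k + 1) A fun (_ : Fin n → Set ℕ) _ _ W => ∃ x, x ∈ W l := by
  refine ⟨ex1 0 (mem 0 l), by simp [qd], by simp [fv1], by simpa [fv2] using hl, ?_⟩
  intro P a b v W _
  simp [Sat]

theorem exists_lt {l m : ℕ} (hl : l ∈ A) (hm : m ∈ A) :
    Expressible (k + 2) A fun (_ : Fin n → Set ℕ) _ _ W =>
      ∃ x y, x ∈ W l ∧ y ∈ W m ∧ x < y := by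
  refine ⟨ex1 0 (ex1 1 (MSO.and (mem 0 l) (MSO.and (mem 1 m) (lt 0 1)))), by simp [qd],
    by ext; simp [fv1], by simp [fv2, hl, hm], ?_⟩
  intro P a b v W _
  simp [Sat, subRel]

theorem exists_pred {l : ℕ} (hl : l ∈ A) (p : Fin n) :
    Expressible (k + 1) A fun P _ _ W => ∃ x, x ∈ W l ∧ (x : ℕ) ∈ P p := by
  refine ⟨ex1 0 (MSO.and (mem 0 l) (pred p 0)), by simp [qd], by simp [fv1],
    by simpa [fv2] using hl, ?_⟩
  intro P a b v W _
  simp [Sat, subPred]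

theorem exists_mem {l m : ℕ} (hl : l ∈ A) (hm : m ∈ A) :
    Expressible (k + 1) A fun (_ : Fin n → Set ℕ) _ _ W => ∃ x, x ∈ W l ∧ x ∈ W m := by
  refine ⟨ex1 0 (MSO.and (mem 0 l) (mem 0 m)), by simp [qd], by simp [fv1],
    by simp [fv2, hl, hm], ?_⟩
  intro P a b v W _
  simp [Sat]

theorem exists_first {l : ℕ} (hl : l ∈ A) :
    Expressible (k + 2) A fun (_ : Fin n → Set ℕ) a _ W => ∃ x, x ∈ W l ∧ (x : ℕ) = a := by
  refine ⟨ex1 0 (MSO.and (mem 0 l) (MSO.not (ex1 1 (lt 1 0)))), by simp [qd],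
    by ext; simp [fv1]; tauto, by simp [fv2, hl], ?_⟩
  intro P a b v W _
  refine exists_congr fun x => and_congr (by simp [Sat]) ?_
  constructor
  · intro hx
    by_contra hne
    refine hx ⟨⟨a, le_rfl, x.2.1.trans_lt x.2.2⟩, ?_⟩
    exact lt_of_le_of_ne x.2.1 (Ne.symm hne)
  · rintro hx ⟨y, hy⟩
    have hy : (y : ℕ) < x := hy
    have := y.2.1
    omega

theorem singleton (k l : ℕ) :
    Expressible (k + 2) {l} fun (_ : Fin n → Set ℕ) _ _ W => ∃ x, W l = {x} := by
  have h₁ : Expressible (k + 2) {l} fun (_ : Fin n → Set ℕ) _ _ W => ∃ x, x ∈ W l :=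
    nonempty (Set.mem_singleton l)
  have h₂ := exists_lt (n := n) (k := k) (Set.mem_singleton l) (Set.mem_singleton l)
  refine (h₁.inter h₂.compl).of_iff fun P a b W _ => ?_
  constructor
  · rintro ⟨⟨x, hx⟩, h⟩
    refine ⟨x, Set.eq_singleton_iff_unique_mem.2 ⟨hx, fun y hy => ?_⟩⟩
    push Not at h
    exact le_antisymm (h x y hx hy) (h y x hy hx)
  · rintro ⟨x, hx⟩
    refine ⟨⟨x, hx ▸ rfl⟩, ?_⟩
    rintro ⟨y, z, hy, hz, hyz⟩
    rw [hx] at hy hz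
    exact hyz.ne (hy.trans hz.symm)

end Expressible

/-- The interpretation of the first-order variables carried by a set assignment. -/
def evenTracks {a b : ℕ} (W : ℕ → Set (Set.Ico a b)) : ℕ → Set ℕ :=
  fun i => Subtype.val '' W (2 * i)

/-- The interpretation of the set variables carried by a set assignment. -/
def oddTracks {a b : ℕ} (W : ℕ → Set (Set.Ico a b)) : ℕ → Set ℕ :=
  fun j => Subtype.val '' W (2 * j + 1)

section Tracks

variable {a b : ℕ} (W : ℕ → Set (Set.Ico a b)) (X : Set (Set.Ico a b))

theorem evenTracks_update_even (i : ℕ) : evenTracks (Function.update W (2 * i) X) =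
    Function.update (evenTracks W) i (Subtype.val '' X) := by
  funext j
  by_cases hj : j = i
  · subst hj; simp [evenTracks]
  · simp [evenTracks, hj]

theorem oddTracks_update_even (i : ℕ) : oddTracks (Function.update W (2 * i) X) = oddTracks W := by
  funext j
  have : 2 * j + 1 ≠ 2 * i := by omega
  simp [oddTracks, this]

theorem evenTracks_update_odd (i : ℕ) :
    evenTracks (Function.update W (2 * i + 1) X) = evenTracks W := by
  funext j
  have : 2 * j ≠ 2 * i + 1 := by omega
  simp only [evenTracks, Function.update_of_ne this]

theorem oddTracks_update_odd (i : ℕ) : oddTracks (Function.update W (2 * i + 1) X) =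
    Function.update (oddTracks W) i (Subtype.val '' X) := by
  funext j
  by_cases hj : j = i
  · subst hj; simp [oddTracks]
  · simp [oddTracks, hj]

end Tracks

/-- The set variables representing the free variables of `φ`. -/
def trackVars (φ : MSO (n + 1)) : Set ℕ :=
  {l | (∃ i ∈ fv1 φ, l = 2 * i) ∨ ∃ j ∈ fv2 φ, l = 2 * j + 1}

/-- The labels of a segment whose only point in the distinguished set is its first one. -/
def markFirst (P : Fin n → Set ℕ) (a : ℕ) : Fin (n + 1) → Set ℕ :=
  Fin.cons {a} P

theorem exists_mem_image_iff {a b : ℕ} {Y : Set (Set.Ico a b)} {R : ℕ → Prop} :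
    (∃ x ∈ Set.Ico a b, x ∈ Subtype.val '' Y ∧ R x) ↔ ∃ x, x ∈ Y ∧ R (x : ℕ) := by
  constructor
  · rintro ⟨_, -, ⟨x, hx, rfl⟩, hR⟩
    exact ⟨x, hx, hR⟩
  · rintro ⟨x, hx, hR⟩
    exact ⟨x, x.2, ⟨x, hx, rfl⟩, hR⟩

/-- Every `φ`-type, where `φ` may mention the distinguished set, is expressed by a formula not
mentioning it, on the segments where only the first point lies in that set. -/
theorem expressible_segType (φ : MSO (n + 1)) : ∀ s : SegType φ,
    Expressible (n := n) (qd φ + 2) (trackVars φ) fun P a b W =>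
      segType (markFirst P a) φ (evenTracks W) (oddTracks W) a b = s := by
  induction φ with
  | lt i j =>
    rintro ⟨s₁, s₂, s₃⟩
    have hi : 2 * i ∈ trackVars (lt i j : MSO (n + 1)) := Or.inl ⟨i, by simp [fv1], rfl⟩
    have hj : 2 * j ∈ trackVars (lt i j : MSO (n + 1)) := Or.inl ⟨j, by simp [fv1], rfl⟩
    have h₁ : Expressible (n := n) 2 _ _ := (Expressible.nonempty hi).iff_const s₁
    have h₂ : Expressible (n := n) 2 _ _ := (Expressible.nonempty hj).iff_const s₂
    have h₃ : Expressible (n := n) 2 _ _ := (Expressible.exists_lt hi hj).iff_const s₃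
    refine (h₁.inter (h₂.inter h₃)).of_iff fun P a b W _ => ?_
    refine Iff.trans ?_ (Prod.ext_iff.trans (and_congr Iff.rfl Prod.ext_iff)).symm
    refine and_congr (Iff.trans ?_ eq_iff_iff.symm) (and_congr (Iff.trans ?_ eq_iff_iff.symm)
      (Iff.trans ?_ eq_iff_iff.symm))
    · refine iff_congr ?_ Iff.rfl
      simp [segType, evenTracks, and_assoc]
    · refine iff_congr ?_ Iff.rfl
      simp [segType, evenTracks, and_assoc]
    · refine iff_congr ?_ Iff.rfl
      constructor
      · rintro ⟨x, y, hx, hy, hxy⟩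
        exact ⟨x, x.2, y, y.2, ⟨x, hx, rfl⟩, ⟨y, hy, rfl⟩, hxy⟩
      · rintro ⟨_, -, _, -, ⟨x, hx, rfl⟩, ⟨y, hy, rfl⟩, hxy⟩
        exact ⟨x, y, hx, hy, hxy⟩
  | pred p i =>
    intro s
    have hi : 2 * i ∈ trackVars (pred p i : MSO (n + 1)) := Or.inl ⟨i, by simp [fv1], rfl⟩
    refine Fin.cases ?_ (fun p => ?_) p
    · have h : Expressible (n := n) 2 _ _ := (Expressible.exists_first hi).iff_const s
      refine (h.mono le_rfl ?_).of_iff fun P a b W _ =>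
        Iff.trans (iff_congr ?_ Iff.rfl) eq_iff_iff.symm
      · exact fun l hl => hl
      · exact (exists_mem_image_iff (R := (· = a))).symm
    · have h : Expressible (n := n) 2 _ _ := (Expressible.exists_pred hi p).iff_const s
      refine (h.mono le_rfl ?_).of_iff fun P a b W _ =>
        Iff.trans (iff_congr ?_ Iff.rfl) eq_iff_iff.symm
      · exact fun l hl => hl
      · exact exists_mem_image_iff.symm
  | mem i j =>
    intro s
    have hi : 2 * i ∈ trackVars (mem i j : MSO (n + 1)) := Or.inl ⟨i, by simp [fv1], rfl⟩
    have hj : 2 * j + 1 ∈ trackVars (mem i j : MSO (n + 1)) := Or.inr ⟨j, by simp [fv2], rfl⟩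
    have h : Expressible (n := n) 2 _ _ := (Expressible.exists_mem hi hj).iff_const s
    refine h.of_iff fun P a b W _ => Iff.trans (iff_congr ?_ Iff.rfl) eq_iff_iff.symm
    refine Iff.trans ?_ exists_mem_image_iff.symm
    exact exists_congr fun x => and_congr_right fun _ =>
      (Subtype.val_injective.mem_set_image (s := W (2 * j + 1))).symm
  | not φ ih => exact ih
  | and φ ψ ih₁ ih₂ =>
    rintro ⟨s₁, s₂⟩
    have h₁ := (ih₁ s₁).mono (k' := qd (MSO.and φ ψ) + 2) (A' := trackVars (MSO.and φ ψ))
      (by simp [qd]) (fun l hl => hl.imp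
        (fun ⟨i, hi, h⟩ => ⟨i, Finset.mem_union_left _ hi, h⟩)
        (fun ⟨i, hi, h⟩ => ⟨i, Finset.mem_union_left _ hi, h⟩))
    have h₂ := (ih₂ s₂).mono (k' := qd (MSO.and φ ψ) + 2) (A' := trackVars (MSO.and φ ψ))
      (by simp [qd]) (fun l hl => hl.imp
        (fun ⟨i, hi, h⟩ => ⟨i, Finset.mem_union_right _ hi, h⟩)
        (fun ⟨i, hi, h⟩ => ⟨i, Finset.mem_union_right _ hi, h⟩))
    exact (h₁.inter h₂).of_iff fun P a b W _ =>
      (Prod.ext_iff (x := segType _ (MSO.and φ ψ) _ _ a b) (y := (s₁, s₂))).symm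
  | ex1 i φ ih =>
    rintro ⟨s₁, s₂⟩
    have hA : trackVars φ ⊆ insert (2 * i) (trackVars (ex1 i φ)) := by
      rintro l (⟨m, hm, rfl⟩ | ⟨j, hj, rfl⟩)
      · by_cases hmi : m = i
        · exact Or.inl (by rw [hmi])
        · exact Or.inr (Or.inl ⟨m, by simp [fv1, hm, hmi], rfl⟩)
      · exact Or.inr (Or.inr ⟨j, hj, rfl⟩)
    have hA' : insert (2 * i) (trackVars φ) ⊆ insert (2 * i) (trackVars (ex1 i φ)) :=
      Set.insert_subset (Set.mem_insert _ _) hA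
    have ih' (s : SegType φ) := (ih s).mono le_rfl (Set.subset_insert (2 * i) (trackVars φ))
    have hne : Expressible (n := n) (qd φ + 2) (insert (2 * i) (trackVars φ)) _ :=
      (Expressible.nonempty (Set.mem_insert (2 * i) (trackVars φ))).compl
    have hsing := (Expressible.singleton (n := n) (qd φ) (2 * i)).mono le_rfl
      (Set.singleton_subset_iff.2 (Set.mem_insert (2 * i) (trackVars φ)))
    have h₁ := (hne.inter (ih' s₁)).exists_set (2 * i) hA'
    have h₂ := Expressible.forall_finite fun s : SegType φ =>
      ((hsing.inter (ih' s)).exists_set (2 * i) hA').iff_const (s ∈ s₂)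
    refine ((h₁.inter h₂).mono (by simp [qd]) subset_rfl).of_iff fun P a b W _ => ?_
    refine Iff.trans ?_ Prod.ext_iff.symm
    refine and_congr ?_ (Iff.trans (forall_congr' fun s => iff_congr ?_ Iff.rfl) Set.ext_iff.symm)
    · change _ ↔ segType _ φ (Function.update _ i ∅) _ a b = s₁
      simp only [evenTracks_update_even, oddTracks_update_even, Function.update_self]
      constructor
      · rintro ⟨X, hX, h⟩
        obtain rfl : X = ∅ := Set.eq_empty_iff_forall_notMem.2 (not_exists.1 hX)
        simpa using h
      · intro h
        exact ⟨∅, by simp, by simpa using h⟩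
    · simp only [evenTracks_update_even, oddTracks_update_even, Function.update_self]
      constructor
      · rintro ⟨_, ⟨x, rfl⟩, h⟩
        exact ⟨x, x.2, by simpa using h⟩
      · rintro ⟨x, hx, h⟩
        exact ⟨{⟨x, hx⟩}, ⟨_, rfl⟩, by simpa using h⟩
  | ex2 j φ ih =>
    intro t
    have hA : trackVars φ ⊆ insert (2 * j + 1) (trackVars (ex2 j φ)) := by
      rintro l (⟨m, hm, rfl⟩ | ⟨m, hm, rfl⟩)
      · exact Or.inr (Or.inl ⟨m, hm, rfl⟩)
      · by_cases hmj : m = j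
        · exact Or.inl (by rw [hmj])
        · exact Or.inr (Or.inr ⟨m, by simp [fv2, hm, hmj], rfl⟩)
    have h₂ := Expressible.forall_finite fun s : SegType φ =>
      ((ih s).exists_set (2 * j + 1) hA).iff_const (s ∈ (show Set (SegType φ) from t))
    refine (h₂.mono (by simp [qd]) subset_rfl).of_iff fun P a b W hab => ?_
    refine Iff.trans (forall_congr' fun s => iff_congr ?_ Iff.rfl) Set.ext_iff.symm
    simp only [evenTracks_update_odd, oddTracks_update_odd]
    constructor
    · rintro ⟨X, h⟩
      exact ⟨_, h⟩
    · rintro ⟨X, rfl⟩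
      refine ⟨Subtype.val ⁻¹' X, ?_⟩
      refine segType_local φ _ hab (fun _ _ _ => Iff.rfl) fun x hx =>
        mem_update_iff j (fun _ => Iff.rfl) ?_
      simp only [Subtype.image_preimage_coe, Set.mem_inter_iff, hx, true_and]

theorem segType_markFirst (φ : MSO (n + 1)) (P : Fin n → Set ℕ) {h : ℕ → ℕ} (hh : StrictMono h)
    (F V : ℕ → Set ℕ) (i : ℕ) :
    segType (Fin.cons (Set.range h) P) φ F V (h i) (h (i + 1)) =
      segType (markFirst P (h i)) φ F V (h i) (h (i + 1)) := by
  obtain ⟨L, hL⟩ := Nat.exists_eq_add_of_le (hh (Nat.lt_succ_self i)).le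
  rw [Nat.succ_eq_add_one] at hL
  rw [hL]
  refine segType_congr φ (fun x hx k => ?_) (fun _ _ _ => Iff.rfl) (fun _ _ _ => Iff.rfl)
  refine Fin.cases ?_ (fun k => Iff.rfl) k
  change h i + x ∈ Set.range h ↔ h i + x = h i
  constructor
  · rintro ⟨j, hj⟩
    have h₁ : i ≤ j := hh.le_iff_le.1 (by omega)
    have h₂ : j < i + 1 := hh.lt_iff_lt.1 (by omega)
    rw [← hj, le_antisymm (Nat.lt_succ_iff.1 h₂) h₁]
  · intro hx
    exact ⟨i, hx.symm⟩

/-- Late consecutive segments cut out by a uniformly homogeneous set have the same `φ`-types, even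
when `φ` may mention the homogeneous set. -/
theorem segType_eq_of_uniformlyHomogeneous {P : Fin n → Set ℕ} {h : ℕ → ℕ}
    (hH : UniformlyHomogeneous P h) (φ : MSO (n + 1)) (hφ : IsSentence φ) {i j : ℕ}
    (hi : qd φ + 2 ≤ i) (hj : qd φ + 2 ≤ j) :
    segType (Fin.cons (Set.range h) P) φ (fun _ => ∅) (fun _ => ∅) (h i) (h (i + 1)) =
      segType (Fin.cons (Set.range h) P) φ (fun _ => ∅) (fun _ => ∅) (h j) (h (j + 1)) := by
  rw [segType_markFirst φ P hH.1, segType_markFirst φ P hH.1]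
  obtain ⟨χ, hqd, hfv1, hfv2, hχ⟩ := expressible_segType φ
    (segType (markFirst P (h j)) φ (fun _ => ∅) (fun _ => ∅) (h j) (h (j + 1)))
  beta_reduce at hχ
  have hsent : IsSentence χ := by
    refine ⟨hfv1, Finset.eq_empty_of_forall_notMem fun l hl => ?_⟩
    rcases hfv2 l hl with ⟨m, hm, -⟩ | ⟨m, hm, -⟩
    · simp [hφ.1] at hm
    · simp [hφ.2] at hm
  obtain ⟨i, rfl⟩ := Nat.exists_eq_add_of_le hi
  obtain ⟨j, rfl⟩ := Nat.exists_eq_add_of_le hj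
  have hequiv := hH.2 (qd φ + 2) j (j + 1) i (i + 1) (Nat.lt_succ_self j) (Nat.lt_succ_self i)
    χ hsent hqd
  have hle (m : ℕ) : h m ≤ h (m + 1) := (hH.1 (Nat.lt_succ_self m)).le
  have heven (a b : ℕ) : evenTracks (fun _ => (∅ : Set (Set.Ico a b))) = fun _ => (∅ : Set ℕ) := by
    funext; simp [evenTracks]
  have hodd (a b : ℕ) : oddTracks (fun _ => (∅ : Set (Set.Ico a b))) = fun _ => (∅ : Set ℕ) := by
    funext; simp [oddTracks]
  have base (m : ℕ) : Set.Ico (h m) (h (m + 1)) := ⟨h m, le_rfl, hH.1 (Nat.lt_succ_self m)⟩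
  have hj' := (hχ P _ _ (fun _ => base (qd φ + 2 + j)) (fun _ => ∅) (hle _)).2
    (by rw [heven, hodd])
  have hi' := hequiv.1 ((trueIn_iff_sat hsent _ _).2 hj')
  have := (hχ P _ _ (fun _ => base (qd φ + 2 + i)) (fun _ => ∅) (hle _)).1 (hi' _ _)
  rwa [heven, hodd] at this

end MSO
end Paper

namespace Paper
namespace MSO

variable {n : ℕ}

/-- `X` is periodic with period `q` from `p` on. -/
def PeriodicFrom (p q : ℕ) (X : Set ℕ) : Prop :=
  ∀ x, p ≤ x → (x ∈ X ↔ x + q ∈ X)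

theorem PeriodicFrom.add_mul {p q : ℕ} {X : Set ℕ} (hX : PeriodicFrom p q X) {x : ℕ} (hx : p ≤ x)
    (m : ℕ) : x ∈ X ↔ x + q * m ∈ X := by
  induction m with
  | zero => simp
  | succ m ih => rw [ih, hX (x + q * m) (by omega), Nat.mul_succ, Nat.add_assoc]

theorem PeriodicFrom.mono {p q p' q' : ℕ} {X : Set ℕ} (hX : PeriodicFrom p q X) (hp : p ≤ p')
    (hq : q ∣ q') : PeriodicFrom p' q' X := by
  obtain ⟨m, rfl⟩ := hq
  exact fun x hx => hX.add_mul (hp.trans hx) m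

theorem exists_le_card {T : Type} [Finite T] (op : T → T → T) (R : ℕ → Set T)
    (hR : ∀ a b, R (a + b) = Set.image2 op (R a) (R b)) {t : T} (l : ℕ) (hl : 0 < l)
    (ht : t ∈ R l) : ∃ l', 0 < l' ∧ l' ≤ Nat.card T + 1 ∧ t ∈ R l' := by
  have := Fintype.ofFinite T
  induction l using Nat.strong_induction_on with
  | _ l ih =>
    by_cases hle : l ≤ Nat.card T + 1
    · exact ⟨l, hl, hle, ht⟩
    have split (a : Fin (Nat.card T + 1)) :
        ∃ s ∈ R (a + 1), ∃ s' ∈ R (l - (a + 1)), op s s' = t := by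
      have : (a + 1 : ℕ) + (l - (a + 1)) = l := by omega
      rw [← this, hR] at ht
      exact ht
    choose s hs s' hs' hop using split
    obtain ⟨a, b, hab, heq⟩ := Fintype.exists_ne_map_eq_of_card_lt s (by simp)
    wlog hlt : a < b generalizing a b
    · exact this b a hab.symm heq.symm (lt_of_le_of_ne (not_lt.1 hlt) hab.symm)
    refine ih ((a + 1) + (l - (b + 1))) (by omega) (by omega) ?_
    rw [hR]
    exact ⟨_, hs a, _, hs' b, by rw [heq, hop]⟩

/-- A weak form of Ramsey's theorem for finite colourings of pairs. -/
theorem exists_strictMono_const {T : Type} [Finite T] (x : ℕ → ℕ → T) :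
    ∃ (r : T) (b : ℕ → ℕ), StrictMono b ∧ ∀ i, x (b i) (b (i + 1)) = r := by
  have lim (f : ℕ → T) : ∃ c, ∀ᶠ j in (Filter.hyperfilter ℕ : Filter ℕ), f j = c := by
    obtain ⟨c, hc⟩ := ((Filter.hyperfilter ℕ).map f).eq_pure_of_finite
    refine ⟨c, ?_⟩
    have : {c} ∈ (Filter.hyperfilter ℕ).map f := by rw [hc]; exact Set.mem_singleton c
    exact this
  choose c hc using fun i => lim (x i)
  obtain ⟨r, hr⟩ := lim c
  have next (i : {i // c i = r}) : ∃ j : {i // c i = r}, (i : ℕ) < j ∧ x i j = r := by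
    have hgt : ∀ᶠ j in (Filter.hyperfilter ℕ : Filter ℕ), (i : ℕ) < j :=
      Nat.hyperfilter_le_atTop (Filter.eventually_gt_atTop (i : ℕ))
    obtain ⟨j, hj₁, hj₂, hj₃⟩ := (hgt.and ((hc i).and hr)).exists
    exact ⟨⟨j, hj₃⟩, hj₁, hj₂.trans i.2⟩
  choose f hf₁ hf₂ using next
  obtain ⟨i₀, hi₀⟩ := hr.exists
  refine ⟨r, fun i => (f^[i] ⟨i₀, hi₀⟩ : {i // c i = r}), strictMono_nat_of_lt_succ fun i => ?_,
    fun i => ?_⟩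
  · rw [Function.iterate_succ_apply']; exact hf₁ _
  · simp only [Function.iterate_succ_apply']; exact hf₂ _

section Periodic

variable {P : Fin n → Set ℕ} {F V : ℕ → Set ℕ} {p q : ℕ}

theorem segType_add_mul (φ : MSO n) (hP : ∀ k, PeriodicFrom p q (P k))
    (hF : ∀ i, ∀ x ∈ F i, x < p) (hV : ∀ j, PeriodicFrom p q (V j)) (m L : ℕ) :
    segType P φ F V (p + q * m) (p + q * m + L) = segType P φ F V p (p + L) := by
  refine segType_congr φ (fun x _ k => ?_) (fun x _ i => ?_) (fun x _ j => ?_)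
  · rw [(hP k).add_mul (Nat.le_add_right p x) m, Nat.add_right_comm]
  · refine iff_of_false (fun h => ?_) (fun h => ?_) <;> have := hF _ _ h <;> omega
  · rw [(hV j).add_mul (Nat.le_add_right p x) m, Nat.add_right_comm]

theorem segType_blocks (φ : MSO n) (hP : ∀ k, PeriodicFrom p q (P k))
    (hF : ∀ i, ∀ x ∈ F i, x < p) (hV : ∀ j, PeriodicFrom p q (V j)) (a b : ℕ) :
    segType P φ F V p (p + q * (a + b)) =
      SegType.comp φ (segType P φ F V p (p + q * a)) (segType P φ F V p (p + q * b)) := by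
  rw [← segType_add_mul φ hP hF hV a (q * b), Nat.mul_add, ← Nat.add_assoc]
  exact segType_comp φ P (Nat.le_add_right _ _) (Nat.le_add_right _ _)

/-- A first-order existential quantifier over an ultimately periodic structure has a small
witness. -/
theorem exists_small_element (φ : MSO n) {v : ℕ → ℕ} (hq : 0 < q)
    (hP : ∀ k, PeriodicFrom p q (P k)) (hp : 0 < p) (hv : ∀ i, v i < p)
    (hV : ∀ j, PeriodicFrom p q (V j)) {K : ℕ} (hK : Nat.card (SegType φ) + 2 ≤ K) {i x : ℕ}
    (hsat : Sat (fun x y : ℕ => x < y) P (Function.update v i x) V φ) :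
    ∃ x' < p + q * K, Sat (fun x y : ℕ => x < y) P (Function.update v i x') V φ := by
  by_cases hx : x < p + q * K
  · exact ⟨x, hx, hsat⟩
  obtain ⟨r, y, hy, rfl⟩ : ∃ r y, y < q ∧ x = p + q * r + y :=
    ⟨(x - p) / q, (x - p) % q, Nat.mod_lt _ hq, by
      have := Nat.div_add_mod (x - p) q
      have : p ≤ x := by omega
      omega⟩
  have hr : 0 < r := by
    rcases Nat.eq_zero_or_pos r with rfl | h
    · have : q * 1 ≤ q * K := Nat.mul_le_mul_left q (by omega)
      omega
    · exact h
  set F₀ : ℕ → Set ℕ := Function.update (singles v) i ∅ with hF₀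
  have hF : ∀ m, ∀ x ∈ F₀ m, x < p := by
    intro m x hx
    by_cases hm : m = i
    · subst hm; simp [hF₀] at hx
    · simp only [hF₀, Function.update_of_ne hm, singles, Set.mem_singleton_iff] at hx
      exact hx ▸ hv m
  obtain ⟨l, hl, hlK, hlr⟩ := exists_le_card (SegType.comp φ)
    (fun l => {segType P φ F₀ V p (p + q * l)})
    (fun a b => by
      rw [Set.image2_singleton, segType_blocks φ hP hF hV]) r hr (Set.mem_singleton _)
  have hlq : q * (l + 1) ≤ q * K := Nat.mul_le_mul_left q (by omega)
  rw [Nat.mul_succ] at hlq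
  refine ⟨p + q * l + y, by omega, ?_⟩
  let t : ℕ → ℕ → ℕ := fun m a => if a = 0 then 0 else p + q * (m + (a - 1))
  have ht (m : ℕ) : StrictMono (t m) := by
    refine strictMono_nat_of_lt_succ fun a => ?_
    rcases Nat.eq_zero_or_pos a with rfl | ha
    · simp [t]; omega
    · obtain ⟨a, rfl⟩ := Nat.exists_eq_add_of_le' ha
      simp [t, Nat.mul_add, hq]
  refine (sat_iff_of_segType_eq φ (ht r) (ht l) (by simp [t]) (by simp [t]) fun a => ?_).1 hsat
  rw [singles_update, singles_update]
  rcases Nat.eq_zero_or_pos a with rfl | ha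
  · have hloc (m : ℕ) : segType P φ (Function.update (singles v) i {p + q * m + y}) V (t m 0)
        (t m (0 + 1)) = segType P φ F₀ V 0 (p + q * m) := by
      refine segType_local φ P (Nat.zero_le _) (fun z hz => ?_) fun _ _ _ => Iff.rfl
      refine mem_update_iff i (fun _ => Iff.rfl) ?_
      have : z < p + q * m := by simpa [t] using hz.2
      simp only [Set.mem_singleton_iff, Set.mem_empty_iff_false, iff_false]
      omega
    rw [hloc, hloc, segType_comp φ P (Nat.zero_le p) (Nat.le_add_right p _),
      segType_comp φ P (Nat.zero_le p) (Nat.le_add_right p (q * l)), Set.mem_singleton_iff.1 hlr]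
  · obtain ⟨a, rfl⟩ := Nat.exists_eq_add_of_le' ha
    have e₁ (m : ℕ) : t m (a + 1) = p + q * (m + a) := by simp [t]
    have e₂ (m : ℕ) : t m (a + 1 + 1) = p + q * (m + a) + q := by simp [t]; ring
    rw [e₁, e₁, e₂, e₂]
    refine segType_congr φ (fun z _ k => ?_) (fun z _ => mem_update_iff i (fun m => ?_) ?_)
      (fun z _ j => ?_)
    · have h (m : ℕ) := (hP k).add_mul (Nat.le_add_right p z) m
      rw [Nat.add_right_comm, ← h, Nat.add_right_comm, ← h]
    · have := hv m
      simp only [singles, Set.mem_singleton_iff]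
      omega
    · simp only [Set.mem_singleton_iff, Nat.mul_add]
      omega
    · have h (m : ℕ) := (hV j).add_mul (Nat.le_add_right p z) m
      rw [Nat.add_right_comm, ← h, Nat.add_right_comm, ← h]

/-- A second-order existential quantifier over an ultimately periodic structure has an ultimately
periodic witness of bounded period. -/
theorem exists_periodic_set (φ : MSO n) {v : ℕ → ℕ} (hq : 0 < q)
    (hP : ∀ k, PeriodicFrom p q (P k)) (hv : ∀ i, v i < p)
    (hV : ∀ j, PeriodicFrom p q (V j)) {K : ℕ} (hK : Nat.card (SegType φ) + 2 ≤ K) {j : ℕ}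
    {X : Set ℕ} (hsat : Sat (fun x y : ℕ => x < y) P v (Function.update V j X) φ) :
    ∃ X', PeriodicFrom (p + q * K) (q * K.factorial) X' ∧
      Sat (fun x y : ℕ => x < y) P v (Function.update V j X') φ := by
  have hF : ∀ m, ∀ x ∈ singles v m, x < p := by
    rintro m _ rfl
    exact hv m
  have short (a b : ℕ) (hab : a < b) (Y : Set ℕ) : ∃ l, 0 < l ∧ l ≤ K ∧ ∃ Z,
      segType P φ (singles v) (Function.update V j Z) p (p + q * l) =
        segType P φ (singles v) (Function.update V j Y) (p + q * a) (p + q * b) := by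
    obtain ⟨d, hd, rfl⟩ : ∃ d, 0 < d ∧ b = a + d := ⟨b - a, by omega, by omega⟩
    obtain ⟨l, hl, hlK, h⟩ := exists_le_card (SegType.comp φ)
      (fun l => (segType P (ex2 j φ) (singles v) V p (p + q * l) : Set (SegType φ)))
      (fun a b => segType_blocks (ex2 j φ) hP hF hV a b) d hd
      (t := segType P φ (singles v) (Function.update V j Y) (p + q * a) (p + q * (a + d)))
      (by
        rw [← segType_add_mul (ex2 j φ) hP hF hV a (q * d), Nat.add_assoc p, ← Nat.mul_add]
        exact ⟨Y, rfl⟩)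
    exact ⟨l, hl, by omega, h⟩
  obtain ⟨r, b, hb, hr⟩ := exists_strictMono_const fun a b =>
    segType P φ (singles v) (Function.update V j X) (p + q * a) (p + q * b)
  have hb₁ : 0 < b 1 := (Nat.zero_le _).trans_lt (hb Nat.zero_lt_one)
  obtain ⟨l₀, hl₀, hl₀K, X₀, hX₀⟩ := short 0 (b 1) hb₁ X
  obtain ⟨l₁, hl₁, hl₁K, X₁, hX₁⟩ := short (b 1) (b 2) (hb (by norm_num)) X
  have hql₀ : 0 < q * l₀ := Nat.mul_pos hq hl₀
  have hql₁ : 0 < q * l₁ := Nat.mul_pos hq hl₁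
  let X' : Set ℕ := {x | x < p ∧ x ∈ X ∨ (p ≤ x ∧ x < p + q * l₀) ∧ x ∈ X₀ ∨
    p + q * l₀ ≤ x ∧ p + (x - (p + q * l₀)) % (q * l₁) ∈ X₁}
  have hX' : PeriodicFrom (p + q * l₀) (q * l₁) X' := by
    intro x hx
    have e : x + q * l₁ - (p + q * l₀) = x - (p + q * l₀) + q * l₁ := by omega
    simp only [X', Set.mem_ofPred_eq, e, Nat.add_mod_right]
    have h₁ : ¬ x < p := by omega
    have h₂ : ¬ x < p + q * l₀ := by omega
    have h₃ : ¬ x + q * l₁ < p := by omega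
    have h₄ : ¬ x + q * l₁ < p + q * l₀ := by omega
    have h₅ : p + q * l₀ ≤ x + q * l₁ := by omega
    simp [h₁, h₂, h₃, h₄, h₅, hx]
  refine ⟨X', hX'.mono (Nat.add_le_add_left (Nat.mul_le_mul_left q hl₀K) p)
    (Nat.mul_dvd_mul_left q (Nat.dvd_factorial hl₁ hl₁K)), ?_⟩
  let t : ℕ → ℕ := fun a => if a = 0 then 0 else p + q * b a
  let t' : ℕ → ℕ := fun a => if a = 0 then 0 else p + q * (l₀ + l₁ * (a - 1))
  have ht : StrictMono t := by
    refine strictMono_nat_of_lt_succ fun a => ?_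
    rcases Nat.eq_zero_or_pos a with rfl | ha
    · have := Nat.mul_pos hq hb₁
      simp [t]; omega
    · simp [t, ha.ne', hq, hb (Nat.lt_succ_self a)]
  have ht' : StrictMono t' := by
    refine strictMono_nat_of_lt_succ fun a => ?_
    rcases Nat.eq_zero_or_pos a with rfl | ha
    · simp [t']; omega
    · obtain ⟨a, rfl⟩ := Nat.exists_eq_add_of_le' ha
      simp [t', Nat.mul_add, hq, hl₁]
  refine (sat_iff_of_segType_eq φ ht ht' (by simp [t]) (by simp [t']) fun a => ?_).1 hsat
  rcases Nat.eq_zero_or_pos a with rfl | ha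
  · have e₁ : t (0 + 1) = p + q * b 1 := by simp [t]
    have e₂ : t' (0 + 1) = p + q * l₀ := by simp [t']
    have e₃ : t 0 = 0 := by simp [t]
    have e₄ : t' 0 = 0 := by simp [t']
    rw [e₁, e₂, e₃, e₄, segType_comp φ P (Nat.zero_le p) (Nat.le_add_right p _),
      segType_comp φ P (Nat.zero_le p) (Nat.le_add_right p (q * l₀))]
    rw [Nat.mul_zero, Nat.add_zero] at hX₀
    rw [← hX₀]
    congr 1
    · refine segType_local φ P (Nat.zero_le p) (fun _ _ _ => Iff.rfl) fun x hx =>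
        mem_update_iff j (fun _ => Iff.rfl) ?_
      have h₁ := hx.2
      have h₂ : ¬ p ≤ x := by omega
      have h₃ : ¬ p + q * l₀ ≤ x := by omega
      simp [X', h₁, h₂, h₃]
    · refine segType_local φ P (Nat.le_add_right _ _) (fun _ _ _ => Iff.rfl) fun x hx =>
        mem_update_iff j (fun _ => Iff.rfl) ?_
      have h₁ := hx.1
      have h₁' := hx.2
      have h₂ : ¬ x < p := by omega
      have h₃ : ¬ p + q * l₀ ≤ x := by omega
      simp [X', h₁, h₁', h₂, h₃]
  · obtain ⟨a, rfl⟩ := Nat.exists_eq_add_of_le' ha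
    have e₁ : t (a + 1) = p + q * b (a + 1) := by simp [t]
    have e₂ : t (a + 1 + 1) = p + q * b (a + 1 + 1) := by simp [t]
    have e₃ : t' (a + 1) = p + q * (l₀ + l₁ * a) := by simp [t']
    have e₄ : t' (a + 1 + 1) = p + q * (l₀ + l₁ * a) + q * l₁ := by simp [t']; ring
    rw [e₁, e₂, e₃, e₄, hr, ← hr 1, ← hX₁]
    refine segType_congr φ (fun z _ k => ?_) (fun z _ m => ?_)
      (fun z hz => mem_update_iff j (fun m => ?_) ?_)
    · rw [Nat.add_right_comm]
      exact (hP k).add_mul (Nat.le_add_right p z) _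
    · have := hv m
      simp only [singles, Set.mem_singleton_iff]
      omega
    · rw [Nat.add_right_comm]
      exact (hV m).add_mul (Nat.le_add_right p z) _
    · have e : p + q * (l₀ + l₁ * a) + z = (p + q * l₀ + z) + q * l₁ * a := by ring
      rw [e, ← hX'.add_mul (Nat.le_add_right _ _)]
      have h₁ : ¬ p + q * l₀ + z < p := by omega
      have h₂ : ¬ p + q * l₀ + z < p + q * l₀ := by omega
      simp [X', h₁, Nat.mod_eq_of_lt hz]

end Periodic

end MSO
end Paper

namespace Paper
namespace MSO

variable {n : ℕ}

/-! ### Ultimately periodic structures -/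

/-- The representative below `p + q` of the class of `x` under the identification of `y` with
`y + q` for `y ≥ p`. -/
def fold (p q x : ℕ) : ℕ := if x < p then x else p + (x - p) % q

theorem fold_of_lt {p q x : ℕ} (hx : x < p + q) : fold p q x = x := by
  unfold fold
  split_ifs with h
  · rfl
  · rw [Nat.mod_eq_of_lt (by omega)]; omega

theorem fold_lt {p q : ℕ} (hq : 0 < q) (x : ℕ) : fold p q x < p + q := by
  unfold fold
  split_ifs with h
  · omega
  · have := Nat.mod_lt (x - p) hq
    omega

theorem fold_add {p q x : ℕ} (hx : p ≤ x) : fold p q (x + q) = fold p q x := by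
  unfold fold
  rw [if_neg (by omega), if_neg (by omega), show x + q - p = x - p + q by omega, Nat.add_mod_right]

theorem fold_add_mul_add {p q y : ℕ} (hy : y < q) (m : ℕ) : fold p q (p + q * m + y) = p + y := by
  unfold fold
  rw [if_neg (by omega), show p + q * m + y - p = y + q * m by omega, Nat.add_mul_mod_self_left,
    Nat.mod_eq_of_lt hy]

theorem periodicFrom_fold (p q : ℕ) (X : Set ℕ) : PeriodicFrom p q {x | fold p q x ∈ X} := by
  intro x hx
  rw [Set.mem_ofPred_eq, Set.mem_ofPred_eq, fold_add hx]

/-- If a property is preserved by shifts by `q` between `p` and `D`, it agrees below `D` with its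
value at folded arguments. -/
theorem iff_fold {Q : ℕ → Prop} {p q D : ℕ} (hq : 0 < q)
    (hQ : ∀ x, p ≤ x → x + q < D → (Q x ↔ Q (x + q))) {x : ℕ} (hx : x < D) :
    Q x ↔ Q (fold p q x) := by
  induction x using Nat.strong_induction_on with
  | _ x ih =>
    by_cases hlt : x < p + q
    · rw [fold_of_lt hlt]
    · obtain ⟨y, rfl⟩ : ∃ y, x = y + q := ⟨x - q, by omega⟩
      rw [fold_add (by omega), ← hQ y (by omega) hx]
      exact ih y (by omega) (by omega)

/-- The truth of a sentence in the expansion by a uniformly homogeneous set is the same as in the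
ultimately periodic structure obtained by repeating one sufficiently late segment. -/
theorem sat_iff_sat_fold {P : Fin n → Set ℕ} {h : ℕ → ℕ} (hH : UniformlyHomogeneous P h)
    (φ : MSO (n + 1)) (hφ : IsSentence φ) {i : ℕ} (hi : qd φ + 2 ≤ i) {q : ℕ} (hq : h i + q = h (i + 1)) :
    Sat (fun x y : ℕ => x < y) (Fin.cons (Set.range h) P) (fun _ => 0) (fun _ => ∅) φ ↔
      Sat (fun x y : ℕ => x < y)
        (fun k => {x | fold (h i) q x ∈ (Fin.cons (Set.range h) P : Fin (n + 1) → Set ℕ) k})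
        (fun _ => 0) (fun _ => ∅) φ := by
  have hqpos : 0 < q := by have := hH.1 (Nat.lt_add_one i); omega
  have hpos (j : ℕ) (hj : 0 < j) : 0 < h j := (Nat.zero_le _).trans_lt (hH.1 hj)
  refine sat_iff_of_segType_eq φ (t := fun a => if a = 0 then 0 else h (i + (a - 1)))
    (t' := fun a => if a = 0 then 0 else h i + q * (a - 1)) ?_ ?_ rfl rfl ?_
  · refine strictMono_nat_of_lt_succ fun a => ?_
    rcases a with _ | a
    · simpa using hpos i (by omega)
    · simpa using hH.1 (show i + a < i + (a + 1) by omega)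
  · refine strictMono_nat_of_lt_succ fun a => ?_
    rcases a with _ | a
    · simpa using hpos i (by omega)
    · simpa using Nat.mul_lt_mul_of_pos_left (Nat.lt_succ_self a) hqpos
  · have hloc {a b : ℕ} (ha : 0 < a) (hab : a ≤ b) (P' : Fin (n + 1) → Set ℕ) :
        segType P' φ (singles fun _ => 0) (fun _ => ∅) a b =
          segType P' φ (fun _ => ∅) (fun _ => ∅) a b := by
      refine segType_local φ P' hab (fun x hx j => ?_) (fun _ _ _ => Iff.rfl)
      have := hx.1
      simp only [singles, Set.mem_singleton_iff, Set.mem_empty_iff_false, iff_false]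
      omega
    rintro (_ | a)
    · have := segType_congr φ (P := (Fin.cons (Set.range h) P : Fin (n + 1) → Set ℕ))
        (P' := fun k => {x | fold (h i) q x ∈ (Fin.cons (Set.range h) P : Fin (n + 1) → Set ℕ) k})
        (F := singles fun _ => 0) (F' := singles fun _ => 0) (V := fun _ => ∅) (V' := fun _ => ∅)
        (a := 0) (a' := 0) (L := h i) (fun x hx k => by
          rw [Set.mem_ofPred_eq, fold_of_lt (by omega)]) (fun _ _ _ => Iff.rfl)
        (fun _ _ _ => Iff.rfl)
      simpa using this
    · simp only [Nat.add_eq_zero_iff, one_ne_zero, and_false, if_false, Nat.add_sub_cancel]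
      rw [show i + (a + 1) = i + a + 1 by omega, hloc (hpos _ (by omega)) (hH.1 (Nat.lt_succ_self _)).le,
        segType_eq_of_uniformlyHomogeneous hH φ hφ (i := i + a) (j := i) (by omega) hi, ← hq,
        hloc ((hpos i (by omega)).trans_le (Nat.le_add_right _ _))
          (Nat.add_le_add_left (Nat.mul_le_mul_left q (Nat.le_succ a)) _),
        Nat.mul_succ, ← Nat.add_assoc]
      refine segType_congr φ (fun x hx k => ?_) (fun _ _ _ => Iff.rfl) (fun _ _ _ => Iff.rfl)
      rw [Set.mem_ofPred_eq, fold_add_mul_add hx]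

/-! ### Digits -/

/-- The `i`-th digit of `e` in base `B`. -/
def digit (B e i : ℕ) : ℕ := e / B ^ i % B

theorem digit_add_pow_mul_of_lt {B N j : ℕ} (hB : 0 < B) (hj : j < N) (e b : ℕ) :
    digit B (e + B ^ N * b) j = digit B e j := by
  obtain ⟨k, rfl⟩ : ∃ k, N = j + (k + 1) := ⟨N - j - 1, by omega⟩
  unfold digit
  rw [show B ^ (j + (k + 1)) * b = B ^ j * (B * (B ^ k * b)) by ring,
    Nat.add_mul_div_left _ _ (pow_pos hB j), Nat.add_mul_mod_self_left]

theorem digit_add_pow_mul_self {B N e b : ℕ} (he : e < B ^ N) (hb : b < B) :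
    digit B (e + B ^ N * b) N = b := by
  unfold digit
  rw [Nat.add_mul_div_left _ _ (pow_pos (by omega) N), Nat.div_eq_of_lt he, Nat.zero_add,
    Nat.mod_eq_of_lt hb]

theorem add_pow_mul_lt {B N e b : ℕ} (he : e < B ^ N) (hb : b < B) :
    e + B ^ N * b < B ^ (N + 1) :=
  calc e + B ^ N * b < B ^ N * (b + 1) := by rw [Nat.mul_succ]; omega
    _ ≤ B ^ (N + 1) := by rw [pow_succ]; exact Nat.mul_le_mul_left _ hb

theorem exists_digit_eq {B : ℕ} (f : ℕ → ℕ) (N : ℕ) (hf : ∀ j < N, f j < B) :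
    ∃ e < B ^ N, ∀ j < N, digit B e j = f j := by
  induction N with
  | zero => exact ⟨0, by simp, by simp⟩
  | succ N ih =>
    obtain ⟨e, he, hd⟩ := ih fun j hj => hf j (by omega)
    have hB := hf N (Nat.lt_succ_self N)
    refine ⟨e + B ^ N * f N, add_pow_mul_lt he hB, fun j hj => ?_⟩
    rcases Nat.lt_succ_iff_lt_or_eq.1 hj with hj | rfl
    · rw [← hd j hj, digit_add_pow_mul_of_lt (by omega) hj]
    · exact digit_add_pow_mul_self he hB

theorem exists_bits (X : Set ℕ) (D : ℕ) : ∃ U < 2 ^ D, ∀ x < D, digit 2 U x = 1 ↔ x ∈ X := by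
  classical
  obtain ⟨U, hU, hd⟩ := exists_digit_eq (B := 2) (fun x => if x ∈ X then 1 else 0) D
    (fun j _ => by split_ifs <;> norm_num)
  refine ⟨U, hU, fun x hx => ?_⟩
  rw [hd x hx]
  split_ifs with h <;> simp [h]

@[simp] theorem digit_zero (B i : ℕ) : digit B 0 i = 0 := by simp [digit]

/-! ### Bounds for quantifiers -/

/-- The ultimate periods `(p, q)` to which quantification can be restricted at depth `d`. -/
def period (K p q : ℕ) : ℕ → ℕ × ℕ
  | 0 => (p, q)
  | d + 1 => ((period K p q d).1 + (period K p q d).2 * K, (period K p q d).2 * K.factorial)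

theorem period_fst_mono (K p q : ℕ) : Monotone fun d => (period K p q d).1 :=
  monotone_nat_of_le_succ fun _ => Nat.le_add_right _ _

theorem period_snd_dvd (K p q : ℕ) {d d' : ℕ} (h : d ≤ d') :
    (period K p q d).2 ∣ (period K p q d').2 := by
  induction h with
  | refl => exact dvd_rfl
  | step _ ih => exact ih.trans (Dvd.intro _ rfl)

theorem period_snd_pos (K : ℕ) (p : ℕ) {q : ℕ} (hq : 0 < q) (d : ℕ) : 0 < (period K p q d).2 := by
  induction d with
  | zero => exact hq
  | succ d ih => exact Nat.mul_pos ih K.factorial_pos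

theorem PeriodicFrom.period_mono {K p q d d' : ℕ} {X : Set ℕ}
    (hX : PeriodicFrom (period K p q d).1 (period K p q d).2 X) (h : d ≤ d') :
    PeriodicFrom (period K p q d').1 (period K p q d').2 X :=
  hX.mono (period_fst_mono K p q h) (period_snd_dvd K p q h)

/-! ### A finite evaluator -/

/-- The data of the evaluator: a bound `C` on codes of formulas, the ultimate period `(p, q)` of
the structure, and a number `w` whose binary digits code the structure. -/
abbrev EvalData : Type := (ℕ × ℕ) × (ℕ × ℕ)

namespace EvalData

/-- The ultimate periods to which quantifiers are restricted at depth `d`. -/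
def per (s : EvalData) (d : ℕ) : ℕ × ℕ := period (typeBound s.1.1 + 2) s.2.1 s.2.2 d

/-- Sets are represented by their restrictions below this bound. -/
def bound (s : EvalData) : ℕ := (s.per (s.1.1 + 2)).1

/-- The base in which environments are written. -/
def base (s : EvalData) : ℕ := 2 ^ s.bound

/-- The number of digits of an environment. -/
def width (s : EvalData) : ℕ := 2 * s.1.1 + 2

/-- The number of environments. -/
def envs (s : EvalData) : ℕ := s.base ^ s.width

/-- One step of the evaluation of the formula with code `c` in the environment `e`, given the
evaluation `R` of formulas with smaller codes. -/
def Step (s : EvalData) (R : ℕ → ℕ → Prop) (c e : ℕ) : Prop :=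
  (c.unpair.1 = 0 ∧
    digit s.base e (2 * c.unpair.2.unpair.1) < digit s.base e (2 * c.unpair.2.unpair.2)) ∨
  (c.unpair.1 = 1 ∧ digit 2 s.1.2 (Nat.pair c.unpair.2.unpair.1
    (fold s.2.1 s.2.2 (digit s.base e (2 * c.unpair.2.unpair.2)))) = 1) ∨
  (c.unpair.1 = 2 ∧ digit 2 (digit s.base e (2 * c.unpair.2.unpair.2 + 1))
    (digit s.base e (2 * c.unpair.2.unpair.1)) = 1) ∨
  (c.unpair.1 = 3 ∧ ¬ R c.unpair.2 e) ∨
  (c.unpair.1 = 4 ∧ R c.unpair.2.unpair.1 e ∧ R c.unpair.2.unpair.2 e) ∨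
  (c.unpair.1 = 5 ∧ ∃ e' < s.envs,
    (∀ j < s.width, j ≠ 2 * c.unpair.2.unpair.1 → digit s.base e' j = digit s.base e j) ∧
    digit s.base e' (2 * c.unpair.2.unpair.1) < (s.per (s.1.1 - c + 1)).1 ∧
    R c.unpair.2.unpair.2 e') ∨
  (c.unpair.1 = 6 ∧ ∃ e' < s.envs,
    (∀ j < s.width, j ≠ 2 * c.unpair.2.unpair.1 + 1 → digit s.base e' j = digit s.base e j) ∧
    (∀ x < s.bound, (s.per (s.1.1 - c + 1)).1 ≤ x → x + (s.per (s.1.1 - c + 1)).2 < s.bound →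
      (digit 2 (digit s.base e' (2 * c.unpair.2.unpair.1 + 1)) x = 1 ↔
        digit 2 (digit s.base e' (2 * c.unpair.2.unpair.1 + 1))
          (x + (s.per (s.1.1 - c + 1)).2) = 1)) ∧
    R c.unpair.2.unpair.2 e')

theorem Step.congr {s : EvalData} {R R' : ℕ → ℕ → Prop} {c e : ℕ} (he : e < s.envs)
    (h : ∀ c' < c, ∀ e' < s.envs, R c' e' ↔ R' c' e') : s.Step R c e ↔ s.Step R' c e := by
  unfold Step
  have h₁ : 0 < c.unpair.1 → c.unpair.2 < c := fun hc =>
    (lt_pair_of_pos hc _).trans_eq (Nat.pair_unpair c)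
  have h₂ : 0 < c.unpair.1 → c.unpair.2.unpair.1 < c := fun hc =>
    (Nat.unpair_left_le _).trans_lt (h₁ hc)
  have h₃ : 0 < c.unpair.1 → c.unpair.2.unpair.2 < c := fun hc =>
    (Nat.unpair_right_le _).trans_lt (h₁ hc)
  refine or_congr Iff.rfl (or_congr Iff.rfl (or_congr Iff.rfl (or_congr ?_ (or_congr ?_
    (or_congr ?_ ?_)))))
  · exact and_congr_right fun hc => not_congr (h _ (h₁ (by omega)) _ he)
  · exact and_congr_right fun hc =>
      and_congr (h _ (h₂ (by omega)) _ he) (h _ (h₃ (by omega)) _ he)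
  all_goals
    exact and_congr_right fun hc => exists_congr fun e' => and_congr_right fun he' =>
      and_congr_right fun _ => and_congr_right fun _ => h _ (h₃ (by omega)) _ he'

end EvalData

end MSO
end Paper

namespace Paper
namespace MSO

variable {n : ℕ}

namespace EvalData

variable {s : EvalData}

theorem base_pos (s : EvalData) : 0 < s.base := pow_pos two_pos _

theorem digit_base_lt (s : EvalData) (e i : ℕ) : digit s.base e i < s.base :=
  Nat.mod_lt _ s.base_pos

theorem per_fst_le_bound {d : ℕ} (hd : d ≤ s.1.1 + 2) : (s.per d).1 ≤ s.bound :=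
  period_fst_mono _ _ _ hd

/-- Some environment has prescribed digits. -/
theorem exists_env (f : ℕ → ℕ) (hf : ∀ j, f j < s.base) :
    ∃ e < s.envs, ∀ j < s.width, digit s.base e j = f j :=
  exists_digit_eq f s.width fun j _ => hf j

/-- The evaluator is correct in ultimately periodic structures coded by its data. -/
theorem iff_sat {P : Fin n → Set ℕ} (hq : 0 < s.2.2)
    (hP : ∀ (k : Fin n) (x : ℕ), x < s.2.1 + s.2.2 → (digit 2 s.1.2 (Nat.pair k x) = 1 ↔ x ∈ P k))
    {R : ℕ → ℕ → Prop} (hR : ∀ c, ∀ e < s.envs, (R c e ↔ s.Step R c e)) (φ : MSO n)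
    (hφ : encode φ ≤ s.1.1) : ∀ {e : ℕ} {v : ℕ → ℕ} {V : ℕ → Set ℕ}, e < s.envs →
      (∀ i, v i < (s.per (s.1.1 - encode φ)).1) →
      (∀ j, PeriodicFrom (s.per (s.1.1 - encode φ)).1 (s.per (s.1.1 - encode φ)).2 (V j)) →
      (∀ i ≤ s.1.1, digit s.base e (2 * i) = v i) →
      (∀ j ≤ s.1.1, ∀ x < s.bound, digit 2 (digit s.base e (2 * j + 1)) x = 1 ↔ x ∈ V j) →
      (R (encode φ) e ↔ Sat (fun x y : ℕ => x < y)
        (fun k => {x | fold s.2.1 s.2.2 x ∈ P k}) v V φ) := by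
  have hle₁ (i j : ℕ) : i ≤ Nat.pair i j := Nat.left_le_pair _ _
  have hle₂ (i j : ℕ) : j ≤ Nat.pair i j := Nat.right_le_pair _ _
  have hper (d : ℕ) (k : Fin n) :
      PeriodicFrom (s.per d).1 (s.per d).2 {x | fold s.2.1 s.2.2 x ∈ P k} :=
    PeriodicFrom.period_mono (d := 0) (periodicFrom_fold _ _ _) (Nat.zero_le d)
  induction φ with
  | lt i j =>
    intro e v V he hv hV hev heV
    have h₂ := hle₂ 0 (Nat.pair i j)
    rw [hR _ _ he]
    simp only [encode] at hφ ⊢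
    simp only [Step, Nat.unpair_pair, Sat, hev i ((hle₁ i j).trans (h₂.trans hφ)),
      hev j ((hle₂ i j).trans (h₂.trans hφ))]
    simp
  | pred k i =>
    intro e v V he hv hV hev heV
    have h₂ := hle₂ 1 (Nat.pair k i)
    rw [hR _ _ he]
    simp only [encode] at hφ ⊢
    simp only [Step, Nat.unpair_pair, Sat, hev i ((hle₂ k i).trans (h₂.trans hφ))]
    simp [hP k _ (fold_lt hq _)]
  | mem i j =>
    intro e v V he hv hV hev heV
    have h₂ := hle₂ 2 (Nat.pair i j)
    rw [hR _ _ he]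
    have hb := (hv i).trans_le (per_fst_le_bound (by omega))
    simp only [encode] at hφ ⊢
    simp only [Step, Nat.unpair_pair, Sat, hev i ((hle₁ i j).trans (h₂.trans hφ)),
      heV j ((hle₂ i j).trans (h₂.trans hφ)) _ hb]
    simp
  | not φ ih =>
    intro e v V he hv hV hev heV
    have hlt := encode_lt_not φ
    have hd : s.1.1 - encode (not φ) ≤ s.1.1 - encode φ := by omega
    have := ih (by omega) he (fun i => (hv i).trans_le (period_fst_mono _ _ _ hd))
      (fun j => (hV j).period_mono hd) hev heV
    rw [hR _ _ he]
    simp only [Step, encode, Nat.unpair_pair, Sat, this]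
    simp
  | and φ ψ ih₁ ih₂ =>
    intro e v V he hv hV hev heV
    have hlt₁ := encode_lt_and_left φ ψ
    have hlt₂ := encode_lt_and_right φ ψ
    have hd₁ : s.1.1 - encode (and φ ψ) ≤ s.1.1 - encode φ := by omega
    have hd₂ : s.1.1 - encode (and φ ψ) ≤ s.1.1 - encode ψ := by omega
    have h₁ := ih₁ (by omega) he (fun i => (hv i).trans_le (period_fst_mono _ _ _ hd₁))
      (fun j => (hV j).period_mono hd₁) hev heV
    have h₂ := ih₂ (by omega) he (fun i => (hv i).trans_le (period_fst_mono _ _ _ hd₂))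
      (fun j => (hV j).period_mono hd₂) hev heV
    rw [hR _ _ he]
    simp only [Step, encode, Nat.unpair_pair, Sat, h₁, h₂]
    simp
  | ex1 i φ ih =>
    intro e v V he hv hV hev heV
    have hlt := encode_lt_ex1 i φ
    have hi : i ≤ s.1.1 := (hle₁ i _).trans ((hle₂ 5 _).trans hφ)
    set d := s.1.1 - encode (ex1 i φ) with hd
    have hd' : d + 1 ≤ s.1.1 - encode φ := by omega
    have hp₁ : (s.per d).1 ≤ (s.per (d + 1)).1 := period_fst_mono _ _ _ (Nat.le_succ d)
    have key {e' : ℕ} {a : ℕ} (he' : e' < s.envs) (ha : a < (s.per (d + 1)).1)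
        (hi' : digit s.base e' (2 * i) = a)
        (hne : ∀ j < s.width, j ≠ 2 * i → digit s.base e' j = digit s.base e j) :
        R (encode φ) e' ↔ Sat (fun x y : ℕ => x < y)
          (fun k => {x | fold s.2.1 s.2.2 x ∈ P k}) (Function.update v i a) V φ := by
      refine ih (by omega) he' (fun m => ?_) (fun j => (hV j).period_mono (by omega))
        (fun m hm => ?_) (fun j hj x hx => ?_)
      · refine lt_of_lt_of_le ?_ (period_fst_mono _ _ _ hd')
        by_cases hm : m = i
        · subst hm; rw [Function.update_self]; exact ha
        · rw [Function.update_of_ne hm]; exact (hv m).trans_le hp₁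
      · by_cases hmi : m = i
        · subst hmi; simpa using hi'
        · rw [Function.update_of_ne hmi, ← hev m hm]
          exact hne _ (by unfold width; omega) (by omega)
      · rw [← heV j hj x hx, hne _ (by unfold width; omega) (by omega)]
    have hstep : R (encode (ex1 i φ)) e ↔ ∃ e' < s.envs,
        (∀ j < s.width, j ≠ 2 * i → digit s.base e' j = digit s.base e j) ∧
        digit s.base e' (2 * i) < (s.per (d + 1)).1 ∧ R (encode φ) e' := by
      rw [hR _ _ he, hd]
      simp only [Step, encode, Nat.unpair_pair]
      simp
    rw [hstep]
    constructor
    · rintro ⟨e', he', hne, hlt', hRe⟩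
      exact ⟨_, (key he' hlt' rfl hne).1 hRe⟩
    · rintro ⟨x, hx⟩
      obtain ⟨a, ha, hsat⟩ := exists_small_element φ (K := typeBound s.1.1 + 2)
        (period_snd_pos _ _ hq d) (hper d) ((Nat.zero_le _).trans_lt (hv 0)) hv hV
        (Nat.add_le_add_right ((card_segType_le φ).trans (typeBound_mono (by omega))) 2) hx
      change a < (s.per (d + 1)).1 at ha
      have hab : a < s.base := (ha.trans_le (per_fst_le_bound (by omega))).trans Nat.lt_two_pow_self
      obtain ⟨e', he', hdig⟩ := exists_env (s := s)
        (Function.update (fun j => digit s.base e j) (2 * i) a) (fun j => by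
          by_cases hj : j = 2 * i
          · subst hj; simpa using hab
          · rw [Function.update_of_ne hj]; exact s.digit_base_lt e j)
      have hi' : digit s.base e' (2 * i) = a := by
        rw [hdig _ (by unfold width; omega), Function.update_self]
      have hne : ∀ j < s.width, j ≠ 2 * i → digit s.base e' j = digit s.base e j := by
        intro j hj hji
        rw [hdig j hj, Function.update_of_ne hji]
      exact ⟨e', he', hne, hi' ▸ ha, (key he' ha hi' hne).2 hsat⟩
  | ex2 i φ ih =>
    intro e v V he hv hV hev heV
    have hlt := encode_lt_ex2 i φ
    have hi : i ≤ s.1.1 := (hle₁ i _).trans ((hle₂ 6 _).trans hφ)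
    set d := s.1.1 - encode (ex2 i φ) with hd
    have hd' : d + 1 ≤ s.1.1 - encode φ := by omega
    have key {e' : ℕ} {X : Set ℕ} (he' : e' < s.envs)
        (hX : PeriodicFrom (s.per (d + 1)).1 (s.per (d + 1)).2 X)
        (hi' : ∀ x < s.bound, digit 2 (digit s.base e' (2 * i + 1)) x = 1 ↔ x ∈ X)
        (hne : ∀ j < s.width, j ≠ 2 * i + 1 → digit s.base e' j = digit s.base e j) :
        R (encode φ) e' ↔ Sat (fun x y : ℕ => x < y)
          (fun k => {x | fold s.2.1 s.2.2 x ∈ P k}) v (Function.update V i X) φ := by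
      refine ih (by omega) he' (fun m => (hv m).trans_le (period_fst_mono _ _ _ (by omega)))
        (fun j => ?_) (fun m hm => ?_) (fun j hj x hx => ?_)
      · by_cases hj : j = i
        · subst hj; rw [Function.update_self]; exact hX.period_mono hd'
        · rw [Function.update_of_ne hj]; exact (hV j).period_mono (by omega)
      · rw [← hev m hm, hne _ (by unfold width; omega) (by omega)]
      · by_cases hji : j = i
        · subst hji; rw [Function.update_self]; exact hi' x hx
        · rw [Function.update_of_ne hji, ← heV j hj x hx,
            hne _ (by unfold width; omega) (by omega)]
    have hstep : R (encode (ex2 i φ)) e ↔ ∃ e' < s.envs,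
        (∀ j < s.width, j ≠ 2 * i + 1 → digit s.base e' j = digit s.base e j) ∧
        (∀ x < s.bound, (s.per (d + 1)).1 ≤ x → x + (s.per (d + 1)).2 < s.bound →
          (digit 2 (digit s.base e' (2 * i + 1)) x = 1 ↔
            digit 2 (digit s.base e' (2 * i + 1)) (x + (s.per (d + 1)).2) = 1)) ∧
        R (encode φ) e' := by
      rw [hR _ _ he, hd]
      simp only [Step, encode, Nat.unpair_pair]
      simp
    rw [hstep]
    constructor
    · rintro ⟨e', he', hne, hshift, hRe⟩
      refine ⟨{x | fold (s.per (d + 1)).1 (s.per (d + 1)).2 x ∈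
        {y | digit 2 (digit s.base e' (2 * i + 1)) y = 1}}, (key he' (periodicFrom_fold _ _ _)
          (fun x hx => ?_) hne).1 hRe⟩
      exact iff_fold (Q := fun y => digit 2 (digit s.base e' (2 * i + 1)) y = 1)
        (period_snd_pos _ _ hq _) (fun y hy hy' => hshift y (by omega) hy hy') hx
    · rintro ⟨Y, hY⟩
      obtain ⟨X, hX, hsat⟩ := exists_periodic_set φ (K := typeBound s.1.1 + 2)
        (period_snd_pos _ _ hq d) (hper d) hv hV
        (Nat.add_le_add_right ((card_segType_le φ).trans (typeBound_mono (by omega))) 2) hY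
      change PeriodicFrom (s.per (d + 1)).1 (s.per (d + 1)).2 X at hX
      obtain ⟨U, hU, hUX⟩ := exists_bits X s.bound
      obtain ⟨e', he', hdig⟩ := exists_env (s := s)
        (Function.update (fun j => digit s.base e j) (2 * i + 1) U) (fun j => by
          by_cases hj : j = 2 * i + 1
          · subst hj; rw [Function.update_self]; exact hU
          · rw [Function.update_of_ne hj]; exact s.digit_base_lt e j)
      have hi' : digit s.base e' (2 * i + 1) = U := by
        rw [hdig _ (by unfold width; omega), Function.update_self]
      have hne : ∀ j < s.width, j ≠ 2 * i + 1 → digit s.base e' j = digit s.base e j := by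
        intro j hj hji
        rw [hdig j hj, Function.update_of_ne hji]
      refine ⟨e', he', hne, fun x hx hpx hqx => ?_, (key he' hX (hi' ▸ hUX) hne).2 hsat⟩
      rw [hi', hUX x hx, hUX _ hqx]
      exact hX x hpx

/-- The evaluator is correct for sentences in ultimately periodic structures coded by its data. -/
theorem iff_sat_sentence {P : Fin n → Set ℕ} (hp : 0 < s.2.1) (hq : 0 < s.2.2)
    (hP : ∀ (k : Fin n) (x : ℕ), x < s.2.1 + s.2.2 → (digit 2 s.1.2 (Nat.pair k x) = 1 ↔ x ∈ P k))
    {R : ℕ → ℕ → Prop} (hR : ∀ c, ∀ e < s.envs, (R c e ↔ s.Step R c e)) (φ : MSO n)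
    (hφ : encode φ = s.1.1) :
    R (encode φ) 0 ↔ Sat (fun x y : ℕ => x < y)
      (fun k => {x | fold s.2.1 s.2.2 x ∈ P k}) (fun _ => 0) (fun _ => ∅) φ := by
  refine iff_sat hq hP hR φ hφ.le (pow_pos s.base_pos _) (fun _ => ?_) (fun _ _ _ => Iff.rfl)
    (fun _ _ => digit_zero _ _) (fun _ _ _ _ => by simp)
  exact hp.trans_le (period_fst_mono _ _ _ (Nat.zero_le _))

end EvalData

end MSO
end Paper

namespace Paper

/-! ### Primitive recursive auxiliary facts -/

/-- The list of the first `m` values of the Boolean function defined by course-of-values recursion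
from `g`. -/
def courseList {α : Type} (g : α → List Bool → Bool) (a : α) : ℕ → List Bool
  | 0 => []
  | m + 1 => courseList g a m ++ [g a (courseList g a m)]

theorem length_courseList {α : Type} (g : α → List Bool → Bool) (a : α) (m : ℕ) :
    (courseList g a m).length = m := by
  induction m with
  | zero => rfl
  | succ m ih => simp [courseList, ih]

theorem getD_courseList {α : Type} (g : α → List Bool → Bool) (a : α) {k m : ℕ} (h : k < m) :
    (courseList g a m).getD k false = g a (courseList g a k) := by
  induction m with
  | zero => omega
  | succ m ih =>
    rcases Nat.lt_succ_iff_lt_or_eq.1 h with h | rfl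
    · rw [← ih h, courseList, List.getD_append _ _ _ _ (by rwa [length_courseList])]
    · rw [courseList, List.getD_append_right _ _ _ _ (by rw [length_courseList]), length_courseList]
      simp

section Primrec

open Primrec

variable {α : Type} [Primcodable α]

theorem primrecPred_exists_lt {f : α → ℕ} {R : α → ℕ → Prop} (hf : Primrec f) (hR : PrimrecRel R) :
    PrimrecPred fun a => ∃ x < f a, R a x :=
  ((PrimrecRel.exists_mem_list (PrimrecRel.swap hR)).comp (list_range.comp hf) Primrec.id).of_eq
    fun a => by simp [Function.swap]

theorem primrecPred_forall_lt {f : α → ℕ} {R : α → ℕ → Prop} (hf : Primrec f) (hR : PrimrecRel R) :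
    PrimrecPred fun a => ∀ x < f a, R a x :=
  ((PrimrecRel.forall_mem_list (PrimrecRel.swap hR)).comp (list_range.comp hf) Primrec.id).of_eq
    fun a => by simp [Function.swap]

theorem primrecPred_imp {p q : α → Prop} (hp : PrimrecPred p) (hq : PrimrecPred q) :
    PrimrecPred fun a => p a → q a :=
  (hp.not.or hq).of_eq fun _ => imp_iff_not_or.symm

theorem primrecPred_iff {p q : α → Prop} (hp : PrimrecPred p) (hq : PrimrecPred q) :
    PrimrecPred fun a => p a ↔ q a :=
  ((primrecPred_imp hp hq).and (primrecPred_imp hq hp)).of_eq fun _ => iff_def.symm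

theorem primrec_pow : Primrec₂ ((· ^ ·) : ℕ → ℕ → ℕ) := by
  refine (nat_rec (f := fun _ : ℕ => 1) (g := fun a p => p.2 * a) (const 1)
    (nat_mul.comp (snd.comp snd) fst)).of_eq fun a => ?_
  intro b
  induction b with
  | zero => rfl
  | succ b ih => rw [pow_succ, ← ih]

theorem primrec_factorial : Primrec Nat.factorial := by
  refine (nat_rec₁ 1 (f := fun k r => (k + 1) * r) (nat_mul.comp (succ.comp fst) snd)).of_eq
    fun b => ?_
  induction b with
  | zero => rfl
  | succ b ih => rw [Nat.factorial_succ, ← ih]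

theorem primrec_courseList {g : α → List Bool → Bool} (hg : Primrec₂ g) :
    Primrec₂ (courseList g) := by
  refine (nat_rec (f := fun _ : α => ([] : List Bool)) (g := fun a p => p.2 ++ [g a p.2]) (const [])
    (list_concat.comp (snd.comp snd) (hg.comp fst (snd.comp snd)))).of_eq fun a => ?_
  intro m
  induction m with
  | zero => rfl
  | succ m ih => rw [courseList, ← ih]

end Primrec

namespace MSO

open Primrec

theorem primrec_typeBound : Primrec typeBound := by
  refine (nat_rec₁ 8 (f := fun _ r => 2 ^ (2 * r))
    (primrec_pow.comp (const 2) (nat_mul.comp (const 2) snd))).of_eq fun b => ?_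
  induction b with
  | zero => rfl
  | succ b ih => rw [typeBound, ← ih]

theorem primrec_digit {α : Type} [Primcodable α] {B e i : α → ℕ} (hB : Primrec B) (he : Primrec e)
    (hi : Primrec i) : Primrec fun a => digit (B a) (e a) (i a) :=
  nat_mod.comp (nat_div.comp he (primrec_pow.comp hB hi)) hB

theorem primrec_fold {α : Type} [Primcodable α] {p q x : α → ℕ} (hp : Primrec p) (hq : Primrec q)
    (hx : Primrec x) : Primrec fun a => fold (p a) (q a) (x a) :=
  Primrec.ite (nat_lt.comp hx hp) hx (nat_add.comp hp (nat_mod.comp (nat_sub.comp hx hp) hq))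

theorem primrec_period {α : Type} [Primcodable α] {K p q d : α → ℕ} (hK : Primrec K)
    (hp : Primrec p) (hq : Primrec q) (hd : Primrec d) :
    Primrec fun a => period (K a) (p a) (q a) (d a) := by
  refine (nat_rec' (g := fun a => (p a, q a))
    (h := fun a r => (r.2.1 + r.2.2 * K a, r.2.2 * (K a).factorial)) hd (hp.pair hq) ?_).of_eq
    fun a => ?_
  · have h₁ : Primrec fun x : α × ℕ × ℕ × ℕ => x.2.2.1 := fst.comp (snd.comp snd)
    have h₂ : Primrec fun x : α × ℕ × ℕ × ℕ => x.2.2.2 := snd.comp (snd.comp snd)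
    exact (nat_add.comp h₁ (nat_mul.comp h₂ (hK.comp fst))).pair
      (nat_mul.comp h₂ (primrec_factorial.comp (hK.comp fst)))
  · generalize d a = m
    induction m with
    | zero => rfl
    | succ m ih => rw [period, ← ih]

namespace EvalData

theorem primrec_per {α : Type} [Primcodable α] {s : α → EvalData} {d : α → ℕ} (hs : Primrec s)
    (hd : Primrec d) : Primrec fun a => (s a).per (d a) :=
  primrec_period (nat_add.comp (primrec_typeBound.comp (fst.comp (fst.comp hs))) (const 2))
    (fst.comp (snd.comp hs)) (snd.comp (snd.comp hs)) hd

theorem primrec_bound : Primrec bound :=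
  fst.comp (primrec_per Primrec.id (nat_add.comp (fst.comp fst) (const 2)))

theorem primrec_base : Primrec base := primrec_pow.comp (const 2) primrec_bound

theorem primrec_width : Primrec width :=
  nat_add.comp (nat_mul.comp (const 2) (fst.comp fst)) (const 2)

theorem primrec_envs : Primrec envs := primrec_pow.comp primrec_base primrec_width

theorem primrecPred_step {α : Type} [Primcodable α] {s : α → EvalData} {c e : α → ℕ}
    {R : α → ℕ → ℕ → Prop} (hs : Primrec s) (hc : Primrec c) (he : Primrec e)
    (hR : PrimrecPred fun x : α × ℕ × ℕ => R x.1 x.2.1 x.2.2) :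
    PrimrecPred fun a => (s a).Step (R a) (c a) (e a) := by
  have htag : Primrec fun a => (c a).unpair.1 := fst.comp (unpair.comp hc)
  have harg : Primrec fun a => (c a).unpair.2 := snd.comp (unpair.comp hc)
  have hl : Primrec fun a => (c a).unpair.2.unpair.1 := fst.comp (unpair.comp harg)
  have hr : Primrec fun a => (c a).unpair.2.unpair.2 := snd.comp (unpair.comp harg)
  have hbase : Primrec fun a => (s a).base := primrec_base.comp hs
  have henvs : Primrec fun a => (s a).envs := primrec_envs.comp hs
  have hwidth : Primrec fun a => (s a).width := primrec_width.comp hs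
  have hbound : Primrec fun a => (s a).bound := primrec_bound.comp hs
  have hper : Primrec fun a => (s a).per ((s a).1.1 - c a + 1) :=
    primrec_per hs (succ.comp (nat_sub.comp (fst.comp (fst.comp hs)) hc))
  have even {f : α → ℕ} (hf : Primrec f) : Primrec fun a => 2 * f a := nat_mul.comp (const 2) hf
  have odd {f : α → ℕ} (hf : Primrec f) : Primrec fun a => 2 * f a + 1 := succ.comp (even hf)
  have hRc {β : Type} [Primcodable β] {f : β → α} {g k : β → ℕ} (hf : Primrec f) (hg : Primrec g)
      (hk : Primrec k) : PrimrecPred fun b => R (f b) (g b) (k b) :=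
    hR.comp (hf.pair (hg.pair hk))
  have tag (m : ℕ) : PrimrecPred fun a => (c a).unpair.1 = m := Primrec.eq.comp htag (const m)
  have agree {f : α → ℕ} (hf : Primrec f) : PrimrecRel fun a e' => ∀ j < (s a).width, j ≠ f a →
      digit (s a).base e' j = digit (s a).base (e a) j := by
    refine primrecPred_forall_lt (f := fun x : α × ℕ => (s x.1).width)
      (R := fun x j => j ≠ f x.1 → digit (s x.1).base x.2 j = digit (s x.1).base (e x.1) j)
      (hwidth.comp fst) (primrecPred_imp ?_ ?_)
    · exact (Primrec.eq.comp snd (hf.comp (fst.comp fst))).not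
    · exact Primrec.eq.comp (primrec_digit (hbase.comp (fst.comp fst)) (snd.comp fst) snd)
        (primrec_digit (hbase.comp (fst.comp fst)) (he.comp (fst.comp fst)) snd)
  have shift : PrimrecRel fun a e' => ∀ x < (s a).bound, ((s a).per ((s a).1.1 - c a + 1)).1 ≤ x →
      x + ((s a).per ((s a).1.1 - c a + 1)).2 < (s a).bound →
      (digit 2 (digit (s a).base e' (2 * (c a).unpair.2.unpair.1 + 1)) x = 1 ↔
        digit 2 (digit (s a).base e' (2 * (c a).unpair.2.unpair.1 + 1))
          (x + ((s a).per ((s a).1.1 - c a + 1)).2) = 1) := by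
    refine primrecPred_forall_lt (f := fun x : α × ℕ => (s x.1).bound)
      (R := fun y x => ((s y.1).per ((s y.1).1.1 - c y.1 + 1)).1 ≤ x →
        x + ((s y.1).per ((s y.1).1.1 - c y.1 + 1)).2 < (s y.1).bound →
        (digit 2 (digit (s y.1).base y.2 (2 * (c y.1).unpair.2.unpair.1 + 1)) x = 1 ↔
          digit 2 (digit (s y.1).base y.2 (2 * (c y.1).unpair.2.unpair.1 + 1))
            (x + ((s y.1).per ((s y.1).1.1 - c y.1 + 1)).2) = 1)) (hbound.comp fst) ?_
    have ha : Primrec fun z : (α × ℕ) × ℕ => z.1.1 := fst.comp fst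
    have hset : Primrec fun z : (α × ℕ) × ℕ =>
        digit (s z.1.1).base z.1.2 (2 * (c z.1.1).unpair.2.unpair.1 + 1) :=
      primrec_digit (hbase.comp ha) (snd.comp fst) ((odd hl).comp ha)
    have hsum : Primrec fun z : (α × ℕ) × ℕ =>
        z.2 + ((s z.1.1).per ((s z.1.1).1.1 - c z.1.1 + 1)).2 :=
      nat_add.comp snd (snd.comp (hper.comp ha))
    exact primrecPred_imp (nat_le.comp (fst.comp (hper.comp ha)) snd)
      (primrecPred_imp (nat_lt.comp hsum (hbound.comp ha))
        (primrecPred_iff (Primrec.eq.comp (primrec_digit (const 2) hset snd) (const 1))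
          (Primrec.eq.comp (primrec_digit (const 2) hset hsum) (const 1))))
  unfold Step
  refine PrimrecPred.or ((tag 0).and ?_) (PrimrecPred.or ((tag 1).and ?_)
    (PrimrecPred.or ((tag 2).and ?_) (PrimrecPred.or ((tag 3).and ?_)
    (PrimrecPred.or ((tag 4).and ?_) (PrimrecPred.or ((tag 5).and ?_) ((tag 6).and ?_))))))
  · exact nat_lt.comp (primrec_digit hbase he (even hl)) (primrec_digit hbase he (even hr))
  · exact Primrec.eq.comp (primrec_digit (const 2) (snd.comp (fst.comp hs)) (Primrec₂.natPair.comp hl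
      (primrec_fold (fst.comp (snd.comp hs)) (snd.comp (snd.comp hs))
        (primrec_digit hbase he (even hr))))) (const 1)
  · exact Primrec.eq.comp (primrec_digit (const 2) (primrec_digit hbase he (odd hr))
      (primrec_digit hbase he (even hl))) (const 1)
  · exact (hRc Primrec.id harg he).not
  · exact (hRc Primrec.id hl he).and (hRc Primrec.id hr he)
  · refine primrecPred_exists_lt henvs (PrimrecPred.and (agree (even hl)) (PrimrecPred.and ?_ ?_))
    · exact nat_lt.comp (primrec_digit (hbase.comp fst) snd ((even hl).comp fst))
        (fst.comp (hper.comp fst))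
    · exact hRc fst (hr.comp fst) snd
  · refine primrecPred_exists_lt henvs (PrimrecPred.and (agree (odd hl)) (PrimrecPred.and shift ?_))
    exact hRc fst (hr.comp fst) snd

open Classical in
/-- The next value of the evaluator, given the list of the previous ones. -/
noncomputable def next (s : EvalData) (L : List Bool) : Bool :=
  decide (s.Step (fun c e => L.getD (c * s.envs + e) false = true)
    (L.length / s.envs) (L.length % s.envs))

/-- The evaluator for the formula with code `c` in the environment `e`. -/
noncomputable def eval (s : EvalData) (c e : ℕ) : Bool :=
  next s (courseList next s (c * s.envs + e))

theorem envs_pos (s : EvalData) : 0 < s.envs := pow_pos s.base_pos _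

theorem eval_iff_step (s : EvalData) (c e : ℕ) (he : e < s.envs) :
    s.eval c e = true ↔ s.Step (fun c' e' => s.eval c' e' = true) c e := by
  classical
  rw [eval, next, decide_eq_true_iff, length_courseList,
    show (c * s.envs + e) / s.envs = c by
      rw [Nat.mul_comm, Nat.mul_add_div s.envs_pos, Nat.div_eq_of_lt he, Nat.add_zero],
    show (c * s.envs + e) % s.envs = e by rw [Nat.mul_comm, Nat.mul_add_mod, Nat.mod_eq_of_lt he]]
  refine Step.congr he fun c' hc' e' he' => ?_
  rw [getD_courseList, eval]
  calc c' * s.envs + e' < (c' + 1) * s.envs := by rw [Nat.succ_mul]; omega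
    _ ≤ c * s.envs := Nat.mul_le_mul_right _ hc'
    _ ≤ _ := Nat.le_add_right _ _

theorem primrec_next : Primrec₂ next := by
  classical
  have hE : Primrec fun x : EvalData × List Bool => x.1.envs := primrec_envs.comp fst
  have hlen : Primrec fun x : EvalData × List Bool => x.2.length := list_length.comp snd
  refine (PrimrecPred.decide (primrecPred_step (s := fun x : EvalData × List Bool => x.1)
    (c := fun x => x.2.length / x.1.envs) (e := fun x => x.2.length % x.1.envs)
    (R := fun x c e => x.2.getD (c * x.1.envs + e) false = true) fst (nat_div.comp hlen hE)
    (nat_mod.comp hlen hE) ?_)).of_eq fun x => by rw [next]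
  exact Primrec.eq.comp ((list_getD false).comp (snd.comp fst) (nat_add.comp
    (nat_mul.comp (fst.comp snd) (hE.comp fst)) (snd.comp snd))) (const true)

theorem primrec_eval {α : Type} [Primcodable α] {s : α → EvalData} {c e : α → ℕ} (hs : Primrec s)
    (hc : Primrec c) (he : Primrec e) : Primrec fun a => (s a).eval (c a) (e a) :=
  primrec_next.comp hs ((primrec_courseList primrec_next).comp hs
    (nat_add.comp (nat_mul.comp hc (primrec_envs.comp hs)) he))

end EvalData

end MSO
end Paper

namespace Paper
namespace MSO

open Primrec

/-! ### Recognizing codes of sentences -/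

/-- One step of the recursive analysis of codes. For `s.1 = 0` it is checked whether the first-order
variable `s.2` is free, for `s.1 = 1` whether the set variable `s.2` is free, and for `s.1 = 2`
whether the number fails to be the code of a formula with `n` predicates. -/
def FlawStep (n : ℕ) (s : ℕ × ℕ) (R : ℕ → Prop) (c : ℕ) : Prop :=
  (c.unpair.1 = 0 ∧ s.1 = 0 ∧ (s.2 = c.unpair.2.unpair.1 ∨ s.2 = c.unpair.2.unpair.2)) ∨
  (c.unpair.1 = 1 ∧ ((s.1 = 0 ∧ s.2 = c.unpair.2.unpair.2) ∨
    (s.1 = 2 ∧ n ≤ c.unpair.2.unpair.1))) ∨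
  (c.unpair.1 = 2 ∧ ((s.1 = 0 ∧ s.2 = c.unpair.2.unpair.1) ∨
    (s.1 = 1 ∧ s.2 = c.unpair.2.unpair.2))) ∨
  (c.unpair.1 = 3 ∧ R c.unpair.2) ∨
  (c.unpair.1 = 4 ∧ (R c.unpair.2.unpair.1 ∨ R c.unpair.2.unpair.2)) ∨
  (c.unpair.1 = 5 ∧ R c.unpair.2.unpair.2 ∧ ¬ (s.1 = 0 ∧ s.2 = c.unpair.2.unpair.1)) ∨
  (c.unpair.1 = 6 ∧ R c.unpair.2.unpair.2 ∧ ¬ (s.1 = 1 ∧ s.2 = c.unpair.2.unpair.1)) ∨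
  (7 ≤ c.unpair.1 ∧ s.1 = 2)

theorem FlawStep.congr {n : ℕ} {s : ℕ × ℕ} {R R' : ℕ → Prop} {c : ℕ}
    (h : ∀ c' < c, R c' ↔ R' c') : FlawStep n s R c ↔ FlawStep n s R' c := by
  unfold FlawStep
  have h₁ : 0 < c.unpair.1 → c.unpair.2 < c := fun hc =>
    (lt_pair_of_pos hc _).trans_eq (Nat.pair_unpair c)
  have h₂ : 0 < c.unpair.1 → c.unpair.2.unpair.1 < c := fun hc =>
    (Nat.unpair_left_le _).trans_lt (h₁ hc)
  have h₃ : 0 < c.unpair.1 → c.unpair.2.unpair.2 < c := fun hc =>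
    (Nat.unpair_right_le _).trans_lt (h₁ hc)
  refine or_congr Iff.rfl (or_congr Iff.rfl (or_congr Iff.rfl (or_congr ?_ (or_congr ?_
    (or_congr ?_ (or_congr ?_ Iff.rfl))))))
  · exact and_congr_right fun hc => h _ (h₁ (by omega))
  · exact and_congr_right fun hc => or_congr (h _ (h₂ (by omega))) (h _ (h₃ (by omega)))
  all_goals exact and_congr_right fun hc => and_congr_left fun _ => h _ (h₃ (by omega))

open Classical in
/-- The next value in the analysis of codes, given the list of the previous ones. -/
noncomputable def flawNext (n : ℕ) (s : ℕ × ℕ) (L : List Bool) : Bool :=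
  decide (FlawStep n s (fun c => L.getD c false = true) L.length)

/-- The analysis of codes described in `FlawStep`. -/
noncomputable def flaw (n : ℕ) (s : ℕ × ℕ) (c : ℕ) : Bool :=
  flawNext n s (courseList (flawNext n) s c)

theorem flaw_iff_step (n : ℕ) (s : ℕ × ℕ) (c : ℕ) :
    flaw n s c = true ↔ FlawStep n s (fun c' => flaw n s c' = true) c := by
  classical
  rw [flaw, flawNext, decide_eq_true_iff, length_courseList]
  refine FlawStep.congr fun c' hc' => ?_
  rw [getD_courseList _ _ hc', flaw]

theorem primrec_flawNext (n : ℕ) : Primrec₂ (flawNext n) := by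
  classical
  refine PrimrecPred.decide (p := fun x : (ℕ × ℕ) × List Bool =>
    FlawStep n x.1 (fun c => x.2.getD c false = true) x.2.length) ?_
  have hc : Primrec fun x : (ℕ × ℕ) × List Bool => x.2.length.unpair := unpair.comp (list_length.comp snd)
  have hl : Primrec fun x : (ℕ × ℕ) × List Bool => x.2.length.unpair.2.unpair.1 :=
    fst.comp (unpair.comp (snd.comp hc))
  have hr : Primrec fun x : (ℕ × ℕ) × List Bool => x.2.length.unpair.2.unpair.2 :=
    snd.comp (unpair.comp (snd.comp hc))
  have tag (m : ℕ) : PrimrecPred fun x : (ℕ × ℕ) × List Bool => x.2.length.unpair.1 = m :=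
    Primrec.eq.comp (fst.comp hc) (const m)
  have sort (m : ℕ) : PrimrecPred fun x : (ℕ × ℕ) × List Bool => x.1.1 = m :=
    Primrec.eq.comp (fst.comp fst) (const m)
  have var {f : (ℕ × ℕ) × List Bool → ℕ} (hf : Primrec f) :
      PrimrecPred fun x : (ℕ × ℕ) × List Bool => x.1.2 = f x := Primrec.eq.comp (snd.comp fst) hf
  have get {f : (ℕ × ℕ) × List Bool → ℕ} (hf : Primrec f) :
      PrimrecPred fun x : (ℕ × ℕ) × List Bool => x.2.getD (f x) false = true :=
    Primrec.eq.comp ((list_getD false).comp snd hf) (const true)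
  unfold FlawStep
  exact PrimrecPred.or ((tag 0).and ((sort 0).and ((var hl).or (var hr))))
    (PrimrecPred.or ((tag 1).and (((sort 0).and (var hr)).or
      ((sort 2).and (nat_le.comp (const n) hl))))
    (PrimrecPred.or ((tag 2).and (((sort 0).and (var hl)).or ((sort 1).and (var hr))))
    (PrimrecPred.or ((tag 3).and (get (snd.comp hc)))
    (PrimrecPred.or ((tag 4).and ((get hl).or (get hr)))
    (PrimrecPred.or ((tag 5).and ((get hr).and ((sort 0).and (var hl)).not))
    (PrimrecPred.or ((tag 6).and ((get hr).and ((sort 1).and (var hl)).not))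
    ((nat_le.comp (const 7) (fst.comp hc)).and (sort 2))))))))

theorem primrec_flaw (n : ℕ) : Primrec₂ (flaw n) :=
  (primrec_flawNext n).comp fst ((primrec_courseList (primrec_flawNext n)).comp fst snd)

theorem flaw_encode {n : ℕ} (φ : MSO n) (s : ℕ × ℕ) : flaw n s (encode φ) = true ↔
    (s.1 = 0 ∧ s.2 ∈ fv1 φ) ∨ (s.1 = 1 ∧ s.2 ∈ fv2 φ) := by
  obtain ⟨t, i⟩ := s
  induction φ with
  | lt a b | mem a b => rw [flaw_iff_step]; simp [FlawStep, encode, fv1, fv2]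
  | pred k a => rw [flaw_iff_step]; simp [FlawStep, encode, fv1, fv2, Nat.not_le.2 k.2]
  | not φ ih => rw [flaw_iff_step]; simp [FlawStep, encode, fv1, fv2, ih]
  | and φ ψ ih₁ ih₂ =>
    rw [flaw_iff_step]
    simp only [FlawStep, encode, fv1, fv2, Nat.unpair_pair, ih₁, ih₂, Finset.mem_union]
    simp only [OfNat.ofNat_ne_zero, OfNat.ofNat_ne_one, Nat.reduceEqDiff, Nat.reduceLeDiff,
      false_and, false_or, or_false, true_and]
    simp only [and_or_left]
    exact or_or_or_comm
  | ex1 a φ ih =>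
    rw [flaw_iff_step]
    simp only [FlawStep, encode, fv1, fv2, Nat.unpair_pair, ih, Finset.mem_sdiff,
      Finset.mem_singleton]
    simp only [OfNat.ofNat_ne_zero, OfNat.ofNat_ne_one, Nat.reduceEqDiff, Nat.reduceLeDiff,
      false_and, false_or, or_false, true_and]
    constructor
    · rintro ⟨⟨h₁, h₂⟩ | h, h'⟩
      · exact Or.inl ⟨h₁, h₂, fun h => h' ⟨h₁, h⟩⟩
      · exact Or.inr h
    · rintro (⟨h₁, h₂, h₃⟩ | h)
      · exact ⟨Or.inl ⟨h₁, h₂⟩, fun h => h₃ h.2⟩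
      · exact ⟨Or.inr h, fun h' => by omega⟩
  | ex2 a φ ih =>
    rw [flaw_iff_step]
    simp only [FlawStep, encode, fv1, fv2, Nat.unpair_pair, ih, Finset.mem_sdiff,
      Finset.mem_singleton]
    simp only [OfNat.ofNat_ne_zero, OfNat.ofNat_ne_one, Nat.reduceEqDiff, Nat.reduceLeDiff,
      false_and, false_or, or_false, true_and]
    constructor
    · rintro ⟨h | ⟨h₁, h₂⟩, h'⟩
      · exact Or.inl h
      · exact Or.inr ⟨h₁, h₂, fun h => h' ⟨h₁, h⟩⟩
    · rintro (h | ⟨h₁, h₂, h₃⟩)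
      · exact ⟨Or.inl h, fun h' => by omega⟩
      · exact ⟨Or.inr ⟨h₁, h₂⟩, fun h => h₃ h.2⟩

theorem exists_encode_eq {n c : ℕ} (hc : flaw n (2, 0) c = false) : ∃ φ : MSO n, encode φ = c := by
  induction c using Nat.strong_induction_on with
  | _ c ih =>
    have hstep : ¬ FlawStep n (2, 0) (fun c' => flaw n (2, 0) c' = true) c := by
      rw [← flaw_iff_step, hc]; exact Bool.false_ne_true
    obtain ⟨t, d, rfl⟩ : ∃ t d, c = Nat.pair t d := ⟨_, _, (Nat.pair_unpair c).symm⟩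
    obtain ⟨a, b, rfl⟩ : ∃ a b, d = Nat.pair a b := ⟨_, _, (Nat.pair_unpair d).symm⟩
    have h₁ : 0 < t → Nat.pair a b < Nat.pair t (Nat.pair a b) := fun ht => lt_pair_of_pos ht _
    have h₂ : 0 < t → a < Nat.pair t (Nat.pair a b) := fun ht =>
      (Nat.left_le_pair a b).trans_lt (h₁ ht)
    have h₃ : 0 < t → b < Nat.pair t (Nat.pair a b) := fun ht =>
      (Nat.right_le_pair a b).trans_lt (h₁ ht)
    simp only [FlawStep, Nat.unpair_pair] at hstep
    have ht : t < 7 := by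
      by_contra ht
      exact hstep (by simp [Nat.not_lt.1 ht])
    interval_cases t
    · exact ⟨lt a b, rfl⟩
    · exact ⟨pred ⟨a, by simpa using hstep⟩ b, rfl⟩
    · exact ⟨mem a b, rfl⟩
    · obtain ⟨φ, hφ⟩ := ih _ (h₁ (by norm_num)) (by simpa using hstep)
      exact ⟨not φ, by rw [encode, hφ]⟩
    · obtain ⟨h₄, h₅⟩ : flaw n (2, 0) a = false ∧ flaw n (2, 0) b = false := by simpa using hstep
      obtain ⟨φ, hφ⟩ := ih _ (h₂ (by norm_num)) h₄
      obtain ⟨ψ, hψ⟩ := ih _ (h₃ (by norm_num)) h₅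
      exact ⟨and φ ψ, by rw [encode, hφ, hψ]⟩
    · obtain ⟨φ, hφ⟩ := ih _ (h₃ (by norm_num)) (by simpa using hstep)
      exact ⟨ex1 a φ, by rw [encode, hφ]⟩
    · obtain ⟨φ, hφ⟩ := ih _ (h₃ (by norm_num)) (by simpa using hstep)
      exact ⟨ex2 a φ, by rw [encode, hφ]⟩

theorem le_encode_of_mem_fv {n i : ℕ} (φ : MSO n) (h : i ∈ fv1 φ ∨ i ∈ fv2 φ) : i ≤ encode φ := by
  have hle₁ (t a b : ℕ) : a ≤ Nat.pair t (Nat.pair a b) :=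
    (Nat.left_le_pair a b).trans (Nat.right_le_pair _ _)
  have hle₂ (t a b : ℕ) : b ≤ Nat.pair t (Nat.pair a b) :=
    (Nat.right_le_pair a b).trans (Nat.right_le_pair _ _)
  induction φ with
  | lt a b | mem a b =>
    simp only [fv1, fv2, Finset.mem_insert, Finset.mem_singleton, Finset.notMem_empty, or_false] at h
    rcases h with rfl | rfl
    · exact hle₁ _ _ _
    · exact hle₂ _ _ _
  | pred k a =>
    simp only [fv1, fv2, Finset.mem_singleton, Finset.notMem_empty, or_false] at h
    subst h
    exact hle₂ _ _ _
  | not φ ih => exact (ih h).trans (encode_lt_not φ).le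
  | and φ ψ ih₁ ih₂ =>
    simp only [fv1, fv2, Finset.mem_union] at h
    rcases h with (h | h) | (h | h)
    · exact (ih₁ (Or.inl h)).trans (encode_lt_and_left φ ψ).le
    · exact (ih₂ (Or.inl h)).trans (encode_lt_and_right φ ψ).le
    · exact (ih₁ (Or.inr h)).trans (encode_lt_and_left φ ψ).le
    · exact (ih₂ (Or.inr h)).trans (encode_lt_and_right φ ψ).le
  | ex1 a φ ih =>
    simp only [fv1, fv2, Finset.mem_sdiff] at h
    exact (ih (h.imp_left And.left)).trans (encode_lt_ex1 a φ).le
  | ex2 a φ ih =>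
    simp only [fv1, fv2, Finset.mem_sdiff] at h
    exact (ih (h.imp_right And.left)).trans (encode_lt_ex2 a φ).le

/-- A primitive recursive criterion for `c` to be the code of a sentence. -/
def SentenceCode (n c : ℕ) : Prop :=
  flaw n (2, 0) c = false ∧ ∀ i < c + 1, flaw n (0, i) c = false ∧ flaw n (1, i) c = false

theorem sentenceCode_iff {n c : ℕ} : SentenceCode n c ↔ ∃ φ : MSO n, IsSentence φ ∧ encode φ = c := by
  constructor
  · rintro ⟨h, hv⟩
    obtain ⟨φ, rfl⟩ := exists_encode_eq h
    refine ⟨φ, ⟨?_, ?_⟩, rfl⟩ <;> refine Finset.eq_empty_of_forall_notMem fun i hi => ?_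
    · have := (hv i (Nat.lt_succ_of_le (le_encode_of_mem_fv φ (Or.inl hi)))).1
      rw [(flaw_encode φ (0, i)).2 (Or.inl ⟨rfl, hi⟩)] at this
      exact Bool.noConfusion this
    · have := (hv i (Nat.lt_succ_of_le (le_encode_of_mem_fv φ (Or.inr hi)))).2
      rw [(flaw_encode φ (1, i)).2 (Or.inr ⟨rfl, hi⟩)] at this
      exact Bool.noConfusion this
  · rintro ⟨φ, ⟨h₁, h₂⟩, rfl⟩
    have h (s : ℕ × ℕ) : flaw n s (encode φ) = false := by
      rw [← Bool.not_eq_true, flaw_encode, h₁, h₂]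
      simp
    exact ⟨h _, fun i _ => ⟨h _, h _⟩⟩

theorem primrecPred_sentenceCode (n : ℕ) : PrimrecPred (SentenceCode n) := by
  have h (t : ℕ) : PrimrecRel fun c i : ℕ => flaw n (t, i) c = false :=
    Primrec.eq.comp ((primrec_flaw n).comp ((const t).pair snd) fst) (const false)
  exact PrimrecPred.and
    (Primrec.eq.comp ((primrec_flaw n).comp (const (2, 0)) Primrec.id) (const false))
    (primrecPred_forall_lt succ (PrimrecPred.and (h 0) (h 1)))

end MSO
end Paper

namespace Paper

/-! ### Functions computable from an oracle -/

theorem RecursiveIn.of_partrec {O f : ℕ →. ℕ} (hf : Nat.Partrec f) : RecursiveIn O f := by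
  induction hf with
  | zero => exact .zero
  | succ => exact .succ
  | left => exact .left
  | right => exact .right
  | pair _ _ ih₁ ih₂ => exact .pair ih₁ ih₂
  | comp _ _ ih₁ ih₂ => exact .comp ih₁ ih₂
  | prec _ _ ih₁ ih₂ => exact .prec ih₁ ih₂
  | rfind _ ih => exact .rfind ih

/-- The total function `f` is computable from the set `S`. -/
def TotalIn (S : Set ℕ) (f : ℕ → ℕ) : Prop := RecursiveIn (chi S) fun m => Part.some (f m)

namespace TotalIn

variable {S : Set ℕ} {f g : ℕ → ℕ}

theorem of_primrec (hf : Primrec f) : TotalIn S f :=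
  RecursiveIn.of_partrec (Nat.Partrec.of_primrec (Primrec.nat_iff.1 hf))

theorem comp (hf : TotalIn S f) (hg : TotalIn S g) : TotalIn S fun a => f (g a) := by
  have := RecursiveIn.comp hf hg
  simpa only [TotalIn, Part.bind_eq_bind, Part.bind_some] using this

theorem pair (hf : TotalIn S f) (hg : TotalIn S g) : TotalIn S fun a => Nat.pair (f a) (g a) := by
  have := RecursiveIn.pair hf hg
  simpa [TotalIn, Seq.seq] using this

theorem primrec_comp {F : ℕ → ℕ} (hF : Primrec F) (hf : TotalIn S f) : TotalIn S fun a => F (f a) :=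
  (of_primrec hF).comp hf

theorem primrec_comp₂ {F : ℕ → ℕ → ℕ} (hF : Primrec₂ F) (hf : TotalIn S f) (hg : TotalIn S g) :
    TotalIn S fun a => F (f a) (g a) := by
  have h : Primrec fun m : ℕ => F m.unpair.1 m.unpair.2 :=
    hF.comp (Primrec.fst.comp Primrec.unpair) (Primrec.snd.comp Primrec.unpair)
  simpa only [Nat.unpair_pair] using (of_primrec h).comp (hf.pair hg)

theorem exists_find (hf : TotalIn S f) (hex : ∀ a, ∃ m, f (Nat.pair a m) = 0) :
    ∃ g, TotalIn S g ∧ ∀ a, f (Nat.pair a (g a)) = 0 := by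
  have h := RecursiveIn.rfind hf
  refine ⟨fun a => Nat.find (hex a), ?_, fun a => Nat.find_spec (hex a)⟩
  refine (congrArg (RecursiveIn (chi S)) (funext fun a => ?_)).mp h
  refine Part.eq_some_iff.2 (Nat.mem_rfind.2 ⟨?_, fun {m} hm => ?_⟩)
  · simpa using (Nat.find_spec (hex a))
  · simpa using Nat.find_min (hex a) hm

end TotalIn

namespace MSO

/-- The number whose first `y` binary digits form the characteristic function of `S`. -/
noncomputable def initialSegment (S : Set ℕ) : ℕ → ℕ
  | 0 => 0
  | y + 1 => initialSegment S y + 2 ^ y * S.indicator (fun _ => 1) y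

theorem indicator_lt_two (S : Set ℕ) (x : ℕ) : S.indicator (fun _ => 1) x < 2 := by
  by_cases h : x ∈ S <;> simp [h]

theorem initialSegment_lt (S : Set ℕ) (y : ℕ) : initialSegment S y < 2 ^ y := by
  induction y with
  | zero => simp [initialSegment]
  | succ y ih => exact add_pow_mul_lt ih (indicator_lt_two S y)

theorem digit_initialSegment (S : Set ℕ) {x y : ℕ} (h : x < y) :
    digit 2 (initialSegment S y) x = 1 ↔ x ∈ S := by
  induction y with
  | zero => omega
  | succ y ih =>
    rcases Nat.lt_succ_iff_lt_or_eq.1 h with h | rfl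
    · rw [initialSegment, digit_add_pow_mul_of_lt two_pos h, ih h]
    · rw [initialSegment, digit_add_pow_mul_self (initialSegment_lt S x) (indicator_lt_two S x)]
      by_cases hx : x ∈ S <;> simp [hx]

theorem totalIn_initialSegment (S : Set ℕ) : TotalIn S (initialSegment S) := by
  have hchi : TotalIn S (S.indicator fun _ => 1) := RecursiveIn.oracle
  have hy : Primrec fun m : ℕ => m.unpair.2.unpair.1 :=
    .comp .fst (.comp .unpair (.comp .snd .unpair))
  have hi : Primrec fun m : ℕ => m.unpair.2.unpair.2 :=
    .comp .snd (.comp .unpair (.comp .snd .unpair))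
  have hstep : TotalIn S fun m => m.unpair.2.unpair.2 +
      2 ^ m.unpair.2.unpair.1 * S.indicator (fun _ => 1) m.unpair.2.unpair.1 :=
    TotalIn.primrec_comp₂ Primrec.nat_add (.of_primrec hi)
      (TotalIn.primrec_comp₂ Primrec.nat_mul
        (.of_primrec (primrec_pow.comp (Primrec.const 2) hy)) (hchi.comp (.of_primrec hy)))
  have hrec := RecursiveIn.prec (TotalIn.of_primrec (S := S) (Primrec.const 0)) hstep
  have hunp : TotalIn S fun m => initialSegment S m.unpair.2 := by
    refine (congrArg (RecursiveIn (chi S)) (funext fun m => ?_)).mp hrec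
    simp only [Nat.unpaired, Nat.unpair_pair, Part.bind_eq_bind]
    generalize m.unpair.2 = y
    induction y with
    | zero => rfl
    | succ y ih => simp only [ih, initialSegment, Part.bind_some]
  simpa only [Nat.unpair_pair, id_eq] using
    hunp.comp (TotalIn.of_primrec (Primrec₂.natPair.comp (Primrec.const 0) Primrec.id))

theorem pair_mem_finJoin {m : ℕ} {P : Fin m → Set ℕ} {k : Fin m} {x : ℕ} :
    Nat.pair k x ∈ finJoin P ↔ x ∈ P k := by
  constructor
  · rintro ⟨i, y, h, hy⟩
    obtain ⟨h₁, rfl⟩ := Nat.pair_eq_pair.1 h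
    rwa [Fin.ext h₁]
  · exact fun h => ⟨k, x, rfl, h⟩

/-! ### Searching for a late segment -/

/-- The segment `[p, p + q)` is bounded by consecutive elements of the set coded by `w`, and at
least `c + 2` elements precede it. -/
def LateSegment (c p q w : ℕ) : Prop :=
  0 < q ∧ digit 2 w (Nat.pair 0 p) = 1 ∧ digit 2 w (Nat.pair 0 (p + q)) = 1 ∧
    (∀ x < q, 0 < x → ¬ digit 2 w (Nat.pair 0 (p + x)) = 1) ∧
    c + 2 ≤ ((List.range p).filter fun x => digit 2 w (Nat.pair 0 x) = 1).length

open Primrec in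
theorem primrecPred_lateSegment {α : Type} [Primcodable α] {c p q w : α → ℕ} (hc : Primrec c)
    (hp : Primrec p) (hq : Primrec q) (hw : Primrec w) :
    PrimrecPred fun a => LateSegment (c a) (p a) (q a) (w a) := by
  have hbit {β : Type} [Primcodable β] {f g : β → ℕ} (hf : Primrec f) (hg : Primrec g) :
      PrimrecPred fun b => digit 2 (f b) (Nat.pair 0 (g b)) = 1 :=
    Primrec.eq.comp (primrec_digit (const 2) hf (Primrec₂.natPair.comp (const 0) hg)) (const 1)
  refine PrimrecPred.and (nat_lt.comp (const 0) hq) (PrimrecPred.and (hbit hw hp)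
    (PrimrecPred.and (hbit hw (nat_add.comp hp hq)) (PrimrecPred.and ?_ ?_)))
  · exact primrecPred_forall_lt hq (primrecPred_imp (nat_lt.comp (const 0) snd)
      (hbit (hw.comp fst) (nat_add.comp (hp.comp fst) snd)).not)
  · exact nat_le.comp (nat_add.comp hc (const 2)) (list_length.comp
      ((PrimrecRel.listFilter (R := fun x w => digit 2 w (Nat.pair 0 x) = 1)
        (hbit snd fst)).comp (list_range.comp hp) hw))

theorem length_filter_range {h : ℕ → ℕ} (hh : StrictMono h) {p : ℕ → Prop} [DecidablePred p] {i : ℕ}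
    (hp : ∀ x < h i, p x ↔ x ∈ Set.range h) : ((List.range (h i)).filter fun x => p x).length = i := by
  have hnd : ((List.range (h i)).filter fun x => p x).Nodup := List.nodup_range.filter _
  have hnd' : ((List.range i).map h).Nodup := List.nodup_range.map hh.injective
  have hperm : ((List.range (h i)).filter fun x => p x).Perm ((List.range i).map h) := by
    refine (List.perm_ext_iff_of_nodup hnd hnd').2 fun x => ?_
    simp only [List.mem_filter, List.mem_range, decide_eq_true_eq, List.mem_map]
    constructor
    · rintro ⟨hx, hpx⟩
      obtain ⟨j, rfl⟩ := (hp x hx).1 hpx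
      exact ⟨j, hh.lt_iff_lt.1 hx, rfl⟩
    · rintro ⟨j, hj, rfl⟩
      exact ⟨hh hj, (hp _ (hh hj)).2 ⟨j, rfl⟩⟩
  simpa using hperm.length_eq

theorem LateSegment.exists_index {h : ℕ → ℕ} (hh : StrictMono h) {c p q w : ℕ}
    (hw : ∀ x ≤ p + q, digit 2 w (Nat.pair 0 x) = 1 ↔ x ∈ Set.range h)
    (hl : LateSegment c p q w) : ∃ i, c + 2 ≤ i ∧ h i = p ∧ h i + q = h (i + 1) := by
  obtain ⟨hq, hp, hpq, hgap, hcount⟩ := hl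
  obtain ⟨i, rfl⟩ := (hw p (by omega)).1 hp
  rw [length_filter_range hh fun x hx => hw x (by omega)] at hcount
  obtain ⟨j, hj⟩ := (hw _ le_rfl).1 hpq
  refine ⟨i, hcount, rfl, ?_⟩
  have hij : i + 1 ≤ j := hh.lt_iff_lt.1 (show h i < h j by omega)
  have hle := hh.monotone hij
  have hlt := hh (Nat.lt_add_one i)
  by_contra hne
  refine hgap (h (i + 1) - h i) (by omega) (by omega) ?_
  rw [show h i + (h (i + 1) - h i) = h (i + 1) by omega]
  exact (hw _ (by omega)).2 ⟨_, rfl⟩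

theorem lateSegment_of_index {h : ℕ → ℕ} (hh : StrictMono h) {i q w : ℕ} (hq : h i + q = h (i + 1))
    (hw : ∀ x ≤ h i + q, digit 2 w (Nat.pair 0 x) = 1 ↔ x ∈ Set.range h) {c : ℕ} (hc : c + 2 ≤ i) :
    LateSegment c (h i) q w := by
  have hlt := hh (Nat.lt_add_one i)
  refine ⟨by omega, (hw _ (by omega)).2 ⟨_, rfl⟩, (hw _ le_rfl).2 ⟨_, hq.symm⟩, fun x hx hx0 hbit => ?_,
    ?_⟩
  · obtain ⟨j, hj⟩ := (hw _ (by omega)).1 hbit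
    have h₁ : i < j := hh.lt_iff_lt.1 (by omega)
    have h₂ : j < i + 1 := hh.lt_iff_lt.1 (by omega)
    omega
  · rwa [length_filter_range hh fun x hx => hw x (by omega)]

end MSO
end Paper

namespace Paper

theorem TotalIn.ite_const {S : Set ℕ} {f : ℕ → ℕ} {p : ℕ → Prop} [DecidablePred p]
    (hp : PrimrecPred p) (hf : TotalIn S f) (a b : ℕ) :
    TotalIn S fun x => if p (f x) then a else b :=
  TotalIn.primrec_comp (Primrec.ite hp (Primrec.const a) (Primrec.const b)) hf

namespace MSO

/-- A code for the restriction of `m` sets with join `S` to the interval `[0, p + q]`,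
where `z` codes the pair `(p, q)`. -/
noncomputable def restriction (S : Set ℕ) (m z : ℕ) : ℕ :=
  initialSegment S ((m + z.unpair.1 + z.unpair.2 + 1) ^ 2)

theorem digit_restriction {m : ℕ} (P : Fin m → Set ℕ) (k : Fin m) {x z : ℕ}
    (hx : x ≤ z.unpair.1 + z.unpair.2) :
    digit 2 (restriction (finJoin P) m z) (Nat.pair k x) = 1 ↔ x ∈ P k := by
  rw [restriction, digit_initialSegment, pair_mem_finJoin]
  refine (Nat.pair_lt_max_add_one_sq k x).trans_le (Nat.pow_le_pow_left ?_ 2)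
  have := k.2
  omega

theorem totalIn_restriction (S : Set ℕ) (m : ℕ) : TotalIn S (restriction S m) := by
  have hz : Primrec fun z : ℕ => (m + z.unpair.1 + z.unpair.2 + 1) ^ 2 :=
    primrec_pow.comp (Primrec.succ.comp (Primrec.nat_add.comp (Primrec.nat_add.comp
      (Primrec.const m) (Primrec.fst.comp Primrec.unpair)) (Primrec.snd.comp Primrec.unpair)))
      (Primrec.const 2)
  exact (totalIn_initialSegment S).comp (.of_primrec hz)

open Classical in
theorem exists_totalIn_lateSegment {m : ℕ} {P : Fin (m + 1) → Set ℕ} {h : ℕ → ℕ} (hh : StrictMono h)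
    (hP : P 0 = Set.range h) : ∃ g, TotalIn (finJoin P) g ∧ ∀ c,
      LateSegment c (g c).unpair.1 (g c).unpair.2 (restriction (finJoin P) (m + 1) (g c)) := by
  have hc : Primrec fun t : ℕ => t.unpair.1 := .comp .fst .unpair
  have hz : Primrec fun t : ℕ => t.unpair.2 := .comp .snd .unpair
  have hp : PrimrecPred fun t : ℕ => LateSegment t.unpair.1.unpair.1 t.unpair.1.unpair.2.unpair.1
      t.unpair.1.unpair.2.unpair.2 t.unpair.2 :=
    primrecPred_lateSegment (hc.comp hc) (hc.comp (hz.comp hc)) (hz.comp (hz.comp hc)) hz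
  have hf := TotalIn.ite_const hp ((TotalIn.of_primrec (S := finJoin P) Primrec.id).pair
    ((totalIn_restriction _ (m + 1)).comp (.of_primrec hz))) 0 1
  obtain ⟨g, hg, hg0⟩ := hf.exists_find fun c => by
    have hlt := hh (Nat.lt_add_one (c + 2))
    refine ⟨Nat.pair (h (c + 2)) (h (c + 2 + 1) - h (c + 2)), ?_⟩
    simp only [id_eq, Nat.unpair_pair, ite_eq_left_iff, one_ne_zero, imp_false, not_not]
    refine lateSegment_of_index hh (by omega) (fun x hx => ?_) le_rfl
    rw [← hP]
    exact digit_restriction P 0 (by simpa only [Nat.unpair_pair] using hx)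
  refine ⟨g, hg, fun c => ?_⟩
  simpa only [id_eq, Nat.unpair_pair, ite_eq_left_iff, one_ne_zero, imp_false, not_not] using hg0 c

theorem eval_iff_trueIn {n : ℕ} {P : Fin n → Set ℕ} {h : ℕ → ℕ} (hH : UniformlyHomogeneous P h)
    {w p q : ℕ} (hw : ∀ (k : Fin (n + 1)), ∀ x ≤ p + q,
      digit 2 w (Nat.pair k x) = 1 ↔ x ∈ (Fin.cons (Set.range h) P : Fin (n + 1) → Set ℕ) k)
    {φ : MSO (n + 1)} (hφ : IsSentence φ) (hl : LateSegment (encode φ) p q w) :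
    EvalData.eval ((encode φ, w), (p, q)) (encode φ) 0 = true ↔
      TrueIn (fun x y : ℕ => x < y) (Fin.cons (Set.range h) P) φ := by
  obtain ⟨i, hi, rfl, hq⟩ := hl.exists_index hH.1 (hw 0)
  rw [trueIn_iff_sat hφ (fun _ => 0) fun _ => ∅,
    sat_iff_sat_fold hH φ hφ (by have := qd_le_encode φ; omega) hq]
  exact EvalData.iff_sat_sentence (s := ((encode φ, w), (h i, q)))
    ((Nat.zero_le _).trans_lt (hH.1 (show 0 < i by omega))) hl.1 (fun k x hx => hw k x hx.le)
    (EvalData.eval_iff_step _) φ rfl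

end MSO
end Paper

/-- If the (infinite) set `H = {h 0 < h 1 < ⋯}` is uniformly homogeneous for
`M = (ℕ, <, P₁, …, Pₙ)`, then the MSO theory of the expansion
`M' = (ℕ, <, H, P₁, …, Pₙ)` is recursive in (Turing reducible to) the join of
the sets `H, P₁, …, Pₙ`. -/
theorem stmt_10 {n : ℕ} (P : Fin n → Set ℕ) (h : ℕ → ℕ)
    (hH : UniformlyHomogeneous P h) :
    TuringRed
      (MSO.TheoryCodes (fun x y : ℕ => x < y) (Fin.cons (Set.range h) P))
      (finJoin (Fin.cons (Set.range h) P)) := by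
  classical
  obtain ⟨g, hg, hlate⟩ := MSO.exists_totalIn_lateSegment
    (P := (Fin.cons (Set.range h) P : Fin (n + 1) → Set ℕ)) hH.1 rfl
  have hc : Primrec fun t : ℕ => t.unpair.1 := .comp .fst .unpair
  have hz : Primrec fun t : ℕ => t.unpair.2 := .comp .snd .unpair
  have hcc := hc.comp hc
  have hp : PrimrecPred fun t : ℕ => MSO.SentenceCode (n + 1) t.unpair.1.unpair.1 ∧
      MSO.EvalData.eval ((t.unpair.1.unpair.1, t.unpair.2),
        (t.unpair.1.unpair.2.unpair.1, t.unpair.1.unpair.2.unpair.2)) t.unpair.1.unpair.1 0 = true :=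
    ((MSO.primrecPred_sentenceCode (n + 1)).comp hcc).and (Primrec.eq.comp
      (MSO.EvalData.primrec_eval ((hcc.pair hz).pair
        ((hc.comp (hz.comp hc)).pair (hz.comp (hz.comp hc)))) hcc (Primrec.const 0))
      (Primrec.const true))
  have hf := TotalIn.ite_const hp (((TotalIn.of_primrec Primrec.id).pair hg).pair
    ((MSO.totalIn_restriction _ (n + 1)).comp hg)) 1 0
  refine (congrArg (RecursiveIn _) (funext fun c => congrArg Part.some ?_)).mp hf
  simp only [id_eq, Nat.unpair_pair, Set.indicator_apply]
  refine if_congr ?_ rfl rfl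
  constructor
  · rintro ⟨hs, he⟩
    obtain ⟨φ, hφ, rfl⟩ := MSO.sentenceCode_iff.1 hs
    exact ⟨φ, hφ, rfl, (MSO.eval_iff_trueIn hH (fun k x => MSO.digit_restriction _ k) hφ (hlate _)).1 he⟩
  · rintro ⟨φ, hφ, rfl, ht⟩
    exact ⟨MSO.sentenceCode_iff.2 ⟨φ, hφ, rfl⟩,
      (MSO.eval_iff_trueIn hH (fun k x => MSO.digit_restriction _ k) hφ (hlate _)).2 ht⟩
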